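/- arXiv:2407.20396 — 2 statements merged into one kernel-verified Lean document; each statement's English description precedes it below -/
import Mathlib

section
/- Let ρ be a normalized state on registers S, L, E with a purification |ρ⟩⟨ρ| on S, L, E, P. Suppose there exists a δ-quantum state redistribution protocol for ρ in which Alice holds the registers P and L, Bob initially holds E, the reference party holds S, the register to be transmitted is L, and the quantum communication cost is log|Q| (Q being the encoded register). Then for every ε ∈ [0,1) one has H_min↑^{ε+δ}(S|LE)_ρ ≥ H_min↑^{ε}(S|E)_ρ − 2·log|Q|. Moreover, if the register Q in the state redistribution protocol is classical, then 2·log|Q| can be replaced by log|Q| in this bound. -/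
open scoped Kronecker
open Matrix
open scoped ComplexOrder

noncomputable section
namespace QITLeak

variable {A B : Type*}

/-- Real matrix power via spectral decomposition (Moore–Penrose pseudoinverse powers,
since `(0:ℝ) ^ (p:ℝ) = 0` for `p ≠ 0`). Junk value `0` on non-Hermitian input. -/
noncomputable def mpow [Fintype A] [DecidableEq A] (ρ : Matrix A A ℂ) (p : ℝ) :
    Matrix A A ℂ :=
  if hρ : ρ.IsHermitian then
    (hρ.eigenvectorUnitary : Matrix A A ℂ) *
      Matrix.diagonal (fun i => ((hρ.eigenvalues i ^ p : ℝ) : ℂ)) *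
      (star (hρ.eigenvectorUnitary : Matrix A A ℂ))
  else 0

/-- A normalized state (density matrix). -/
def IsState [Fintype A] (ρ : Matrix A A ℂ) : Prop := ρ.PosSemidef ∧ ρ.trace = 1

/-- A subnormalized state. -/
def IsSubState [Fintype A] (ρ : Matrix A A ℂ) : Prop := ρ.PosSemidef ∧ (ρ.trace).re ≤ 1

/-- Partial trace over the second tensor factor. -/
def ptB [Fintype B] (ρ : Matrix (A × B) (A × B) ℂ) : Matrix A A ℂ :=
  Matrix.of fun a a' => ∑ b, ρ (a, b) (a', b)

/-- Partial trace over the first tensor factor. -/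
def ptA [Fintype A] (ρ : Matrix (A × B) (A × B) ℂ) : Matrix B B ℂ :=
  Matrix.of fun b b' => ∑ a, ρ (a, b) (a, b')

/-- Partial trace over the factor `B`, along a decomposition `X ≃ A × B` of the registers. -/
def traceOut {X A B : Type*} [Fintype B] (e : X ≃ A × B) (ρ : Matrix X X ℂ) :
    Matrix A A ℂ :=
  Matrix.of fun a a' => ∑ b, ρ (e.symm (a, b)) (e.symm (a', b))

/-- Support inclusion `supp ρ ⊆ supp σ` (for PSD matrices: kernel inclusion). -/
def suppSubset [Fintype A] (ρ σ : Matrix A A ℂ) : Prop :=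
  ∀ v : A → ℂ, σ *ᵥ v = 0 → ρ *ᵥ v = 0

/-- The real-valued core formula of the sandwiched Rényi divergence (base 2). -/
def DR (α : ℝ) [Fintype A] [DecidableEq A] (ρ σ : Matrix A A ℂ) : ℝ :=
  (α - 1)⁻¹ * Real.logb 2
    (((mpow (mpow σ ((1 - α) / (2 * α)) * ρ * mpow σ ((1 - α) / (2 * α))) α).trace.re)
      / (ρ.trace).re)

open scoped Classical in
/-- The sandwiched Rényi divergence `D_α(ρ‖σ)`, with value `⊤` outside the
support/orthogonality conditions. -/
def D (α : ℝ) [Fintype A] [DecidableEq A] (ρ σ : Matrix A A ℂ) : EReal :=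
  if (α < 1 ∧ ¬ (ρ * σ = 0 ∧ σ * ρ = 0)) ∨ suppSubset ρ σ then ((DR α ρ σ : ℝ) : EReal)
  else ⊤

/-- The max-divergence `D_∞(ρ‖σ)`: log of the least `μ ≥ 0` with `ρ ≤ μσ` (`⊤` if none). -/
def Dmax [Fintype A] (ρ σ : Matrix A A ℂ) : EReal :=
  sInf {x : EReal | ∃ μ : ℝ, 0 ≤ μ ∧ (μ • σ - ρ).PosSemidef ∧ x = ((Real.logb 2 μ : ℝ) : EReal)}

section Ent
variable [Fintype A] [DecidableEq A] [Fintype B] [DecidableEq B]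

/-- `H_α↑(A|B)_ρ` for `ρ` on `A × B`. -/
def HUp (α : ℝ) (ρ : Matrix (A × B) (A × B) ℂ) : EReal :=
  - sInf {x : EReal | ∃ σ : Matrix B B ℂ, IsState σ ∧ x = D α ρ ((1 : Matrix A A ℂ) ⊗ₖ σ)}

/-- `H_α(A|B)_ρ` for `ρ` on `A × B`. -/
def Hdn (α : ℝ) (ρ : Matrix (A × B) (A × B) ℂ) : EReal :=
  - D α ρ ((1 : Matrix A A ℂ) ⊗ₖ ptA ρ)

/-- `I_α↓(A;B)_ρ` for `ρ` on `A × B`. -/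
def Idown (α : ℝ) (ρ : Matrix (A × B) (A × B) ℂ) : EReal :=
  sInf {x : EReal | ∃ σ : Matrix B B ℂ, IsState σ ∧ x = D α ρ ((ptB ρ) ⊗ₖ σ)}

/-- `I_α(A:B)_ρ` for `ρ` on `A × B`. -/
def Imut (α : ℝ) (ρ : Matrix (A × B) (A × B) ℂ) : EReal :=
  D α ρ ((ptB ρ) ⊗ₖ (ptA ρ))

/-- `I_α↓↓(A:B)_ρ` for `ρ` on `A × B`. -/
def Idd (α : ℝ) (ρ : Matrix (A × B) (A × B) ℂ) : EReal :=
  sInf {x : EReal | ∃ (ω : Matrix A A ℂ) (σ : Matrix B B ℂ),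
    IsState ω ∧ IsState σ ∧ x = D α ρ (ω ⊗ₖ σ)}

/-- `H_min↑(A|B)_ρ = H_∞↑(A|B)_ρ`. -/
def HminUp (ρ : Matrix (A × B) (A × B) ℂ) : EReal :=
  - sInf {x : EReal | ∃ σ : Matrix B B ℂ, IsState σ ∧ x = Dmax ρ ((1 : Matrix A A ℂ) ⊗ₖ σ)}

/-- `I_∞↓(A;B)_ρ`. -/
def ImaxD (ρ : Matrix (A × B) (A × B) ℂ) : EReal :=
  sInf {x : EReal | ∃ σ : Matrix B B ℂ, IsState σ ∧ x = Dmax ρ ((ptB ρ) ⊗ₖ σ)}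

/-- `I_∞(A:B)_ρ` (unoptimized max-information). -/
def ImaxND (ρ : Matrix (A × B) (A × B) ℂ) : EReal :=
  Dmax ρ ((ptB ρ) ⊗ₖ (ptA ρ))

/-- `I_∞↓↓(A:B)_ρ`. -/
def IddMax (ρ : Matrix (A × B) (A × B) ℂ) : EReal :=
  sInf {x : EReal | ∃ (ω : Matrix A A ℂ) (σ : Matrix B B ℂ),
    IsState ω ∧ IsState σ ∧ x = Dmax ρ (ω ⊗ₖ σ)}

end Ent

/-- Trace norm. -/
def traceNorm [Fintype A] [DecidableEq A] (M : Matrix A A ℂ) : ℝ :=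
  (mpow (Mᴴ * M) (1 / 2 : ℝ)).trace.re

/-- Generalized fidelity of subnormalized states. -/
def gFid [Fintype A] [DecidableEq A] (ρ σ : Matrix A A ℂ) : ℝ :=
  traceNorm (mpow ρ (1 / 2 : ℝ) * mpow σ (1 / 2 : ℝ)) +
    Real.sqrt ((1 - ρ.trace.re) * (1 - σ.trace.re))

/-- Purified distance. -/
def pDist [Fintype A] [DecidableEq A] (ρ σ : Matrix A A ℂ) : ℝ :=
  Real.sqrt (1 - gFid ρ σ ^ 2)

section Smooth
variable [Fintype A] [DecidableEq A] [Fintype B] [DecidableEq B]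

/-- Smoothed min-entropy `H_min↑,ε(A|B)_ρ`. -/
def HminUpEps (ε : ℝ) (ρ : Matrix (A × B) (A × B) ℂ) : EReal :=
  sSup {x : EReal | ∃ ρ' : Matrix (A × B) (A × B) ℂ,
    IsSubState ρ' ∧ pDist ρ' ρ ≤ ε ∧ x = HminUp ρ'}

/-- Smoothed max-information `I_max↓,ε(A;B)_ρ`. -/
def ImaxDEps (ε : ℝ) (ρ : Matrix (A × B) (A × B) ℂ) : EReal :=
  sInf {x : EReal | ∃ ρ' : Matrix (A × B) (A × B) ℂ,
    IsSubState ρ' ∧ pDist ρ' ρ ≤ ε ∧ x = ImaxD ρ'}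

/-- Smoothed (unoptimized) max-information `I_max^ε(A:B)_ρ`. -/
def ImaxNDEps (ε : ℝ) (ρ : Matrix (A × B) (A × B) ℂ) : EReal :=
  sInf {x : EReal | ∃ ρ' : Matrix (A × B) (A × B) ℂ,
    IsSubState ρ' ∧ pDist ρ' ρ ≤ ε ∧ x = ImaxND ρ'}

/-- Smoothed max-information `I_max↓↓,ε(A:B)_ρ`. -/
def IddMaxEps (ε : ℝ) (ρ : Matrix (A × B) (A × B) ℂ) : EReal :=
  sInf {x : EReal | ∃ ρ' : Matrix (A × B) (A × B) ℂ,
    IsSubState ρ' ∧ pDist ρ' ρ ≤ ε ∧ x = IddMax ρ'}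

/-- Smoothed Rényi conditional entropy `H_α↑,ε(A|B)_ρ`. -/
def HUpEps (α ε : ℝ) (ρ : Matrix (A × B) (A × B) ℂ) : EReal :=
  sSup {x : EReal | ∃ ρ' : Matrix (A × B) (A × B) ℂ,
    IsSubState ρ' ∧ pDist ρ' ρ ≤ ε ∧ x = HUp α ρ'}

end Smooth

/-- Extension `id_R ⊗ Φ` of a linear map on matrices, with a spectator register on the left. -/
def lext {R A B : Type*} (Φ : Matrix A A ℂ →ₗ[ℂ] Matrix B B ℂ) :
    Matrix (R × A) (R × A) ℂ →ₗ[ℂ] Matrix (R × B) (R × B) ℂ where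
  toFun ρ := Matrix.of fun p q => Φ (Matrix.of fun a a' => ρ (p.1, a) (q.1, a')) p.2 q.2
  map_add' x y := by
    ext p q
    show Φ ((Matrix.of fun a a' => x (p.1, a) (q.1, a'))
        + (Matrix.of fun a a' => y (p.1, a) (q.1, a'))) p.2 q.2 = _
    rw [map_add]; rfl
  map_smul' c x := by
    ext p q
    show Φ (c • (Matrix.of fun a a' => x (p.1, a) (q.1, a'))) p.2 q.2 = _
    rw [_root_.map_smul]; rfl

/-- Extension `Φ ⊗ id_R` of a linear map on matrices, with a spectator register on the right. -/
def rext {A B R : Type*} (Φ : Matrix A A ℂ →ₗ[ℂ] Matrix B B ℂ) :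
    Matrix (A × R) (A × R) ℂ →ₗ[ℂ] Matrix (B × R) (B × R) ℂ where
  toFun ρ := Matrix.of fun p q => Φ (Matrix.of fun a a' => ρ (a, p.2) (a', q.2)) p.1 q.1
  map_add' x y := by
    ext p q
    show Φ ((Matrix.of fun a a' => x (a, p.2) (a', q.2))
        + (Matrix.of fun a a' => y (a, p.2) (a', q.2))) p.1 q.1 = _
    rw [map_add]; rfl
  map_smul' c x := by
    ext p q
    show Φ (c • (Matrix.of fun a a' => x (a, p.2) (a', q.2))) p.1 q.1 = _
    rw [_root_.map_smul]; rfl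

/-- Completely positive trace-preserving map (quantum channel). -/
structure IsCPTP {A B : Type*} [Fintype A] [Fintype B]
    (Φ : Matrix A A ℂ →ₗ[ℂ] Matrix B B ℂ) : Prop where
  cp : ∀ (n : ℕ) (ρ : Matrix (Fin n × A) (Fin n × A) ℂ), ρ.PosSemidef →
    ((lext Φ) ρ).PosSemidef
  tp : ∀ ρ : Matrix A A ℂ, (Φ ρ).trace = ρ.trace

/-- The rank-one (pure) state associated to a vector. -/
def pureState {A : Type*} (ψ : A → ℂ) : Matrix A A ℂ := Matrix.vecMulVec ψ (star ψ)


/-! ## Statement 0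
Chain rule for smoothed min-entropy from a δ-quantum state redistribution protocol:
if `ρ_SLE` (purified by `P`) admits a δ-QSR protocol where Alice holds `P, L`, Bob holds
`E`, the reference holds `S`, the transmitted register is `L`, and the message register
is `Q`, then `H_min↑^{ε+δ}(S|LE)_ρ ≥ H_min↑^{ε}(S|E)_ρ − 2·log|Q|`; if `Q` is classical,
`2·log|Q|` improves to `log|Q|`. -/

/-- `S × (L × E) ≃ (S × E) × L` (trace out `L`). -/
def eSEL (S L E : Type*) : S × (L × E) ≃ (S × E) × L where
  toFun x := ((x.1, x.2.2), x.2.1)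
  invFun y := (y.1.1, (y.2, y.1.2))
  left_inv _ := rfl
  right_inv _ := rfl

/-- Rearrangement for the encoding step: Alice holds `(P × L) × A'`,
spectators are `S, E, B'`. -/
def eEnc (S L E P A' B' : Type*) :
    ((S × (L × E)) × P) × (A' × B') ≃ (S × (E × B')) × ((P × L) × A') where
  toFun x := ((x.1.1.1, (x.1.1.2.2, x.2.2)), ((x.1.2, x.1.1.2.1), x.2.1))
  invFun y := (((y.1.1, (y.2.1.2, y.1.2.1)), y.2.1.1), (y.2.2, y.1.2.2))
  left_inv _ := rfl
  right_inv _ := rfl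

/-- Rearrangement for the decoding step: Bob holds `(Q × E) × B'`,
spectators are `S, P`. -/
def eDec (S E P B' Q : Type*) :
    (S × (E × B')) × (P × Q) ≃ (S × P) × ((Q × E) × B') where
  toFun x := ((x.1.1, x.2.1), ((x.2.2, x.1.2.1), x.1.2.2))
  invFun y := ((y.1.1, (y.2.1.2, y.2.2)), (y.1.2, y.2.1.1))
  left_inv _ := rfl
  right_inv _ := rfl

/-- Rearrangement back to the original register ordering after decoding. -/
def eFin (S L E P : Type*) : (S × P) × (E × L) ≃ (S × (L × E)) × P where
  toFun x := ((x.1.1, (x.2.2, x.2.1)), x.1.2)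
  invFun y := ((y.1.1, y.2), (y.1.2.2, y.1.2.1))
  left_inv _ := rfl
  right_inv _ := rfl

/-- Pinching (decohering) channel on the second register. -/
def pinch2 {P Q : Type*} [DecidableEq Q] (M : Matrix (P × Q) (P × Q) ℂ) :
    Matrix (P × Q) (P × Q) ℂ :=
  Matrix.of fun p q => if p.2 = q.2 then M p q else 0

section SpectralCalculus

open scoped MatrixOrder

variable {m n k : Type*} [Fintype m] [Fintype n] [Fintype k] [DecidableEq n]

/-- A real function applied to a Hermitian matrix through its spectral decomposition. -/
def spectralMap {ρ : Matrix n n ℂ} (hρ : ρ.IsHermitian) (f : ℝ → ℝ) : Matrix n n ℂ :=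
  (hρ.eigenvectorUnitary : Matrix n n ℂ) *
    Matrix.diagonal (fun i => ((f (hρ.eigenvalues i) : ℝ) : ℂ)) *
    (star (hρ.eigenvectorUnitary : Matrix n n ℂ))

lemma mpow_eq_spectralMap {ρ : Matrix n n ℂ} (hρ : ρ.IsHermitian) (p : ℝ) :
    mpow ρ p = spectralMap hρ (fun x => x ^ p) := by
  simp only [mpow, dif_pos hρ, spectralMap]

lemma spectralMap_id {ρ : Matrix n n ℂ} (hρ : ρ.IsHermitian) :
    spectralMap hρ (fun x => x) = ρ := by
  conv_rhs => rw [hρ.spectral_theorem]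
  simp only [Unitary.conjStarAlgAut_apply]
  rfl

lemma spectralMap_one {ρ : Matrix n n ℂ} (hρ : ρ.IsHermitian) :
    spectralMap hρ (fun _ => 1) = 1 := by
  simp [spectralMap]

lemma spectralMap_mul {ρ : Matrix n n ℂ} (hρ : ρ.IsHermitian) (f g : ℝ → ℝ) :
    spectralMap hρ f * spectralMap hρ g = spectralMap hρ (fun x => f x * g x) := by
  have hU : star (hρ.eigenvectorUnitary : Matrix n n ℂ) * hρ.eigenvectorUnitary = 1 := by simp
  simp only [spectralMap]
  calc _ = (hρ.eigenvectorUnitary : Matrix n n ℂ) *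
        Matrix.diagonal (fun i => ((f (hρ.eigenvalues i) : ℝ) : ℂ)) *
        (star (hρ.eigenvectorUnitary : Matrix n n ℂ) * hρ.eigenvectorUnitary) *
        Matrix.diagonal (fun i => ((g (hρ.eigenvalues i) : ℝ) : ℂ)) *
        (star (hρ.eigenvectorUnitary : Matrix n n ℂ)) := by simp only [Matrix.mul_assoc]
    _ = _ := by
        rw [hU, Matrix.mul_one, Matrix.mul_assoc _ (Matrix.diagonal _) (Matrix.diagonal _),
          Matrix.diagonal_mul_diagonal]
        simp only [Complex.ofReal_mul]

lemma spectralMap_congr {ρ : Matrix n n ℂ} (hρ : ρ.PosSemidef) {f g : ℝ → ℝ}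
    (h : ∀ x, 0 ≤ x → f x = g x) : spectralMap hρ.1 f = spectralMap hρ.1 g := by
  simp only [spectralMap, h _ (hρ.eigenvalues_nonneg _)]

lemma spectralMap_conjTranspose {ρ : Matrix n n ℂ} (hρ : ρ.IsHermitian) (f : ℝ → ℝ) :
    (spectralMap hρ f)ᴴ = spectralMap hρ f := by
  simp only [spectralMap, Matrix.star_eq_conjTranspose, Matrix.conjTranspose_mul,
    Matrix.conjTranspose_conjTranspose, Matrix.diagonal_conjTranspose, Matrix.mul_assoc]
  congr 3
  ext i
  simp

lemma spectralMap_sub {ρ : Matrix n n ℂ} (hρ : ρ.IsHermitian) (f g : ℝ → ℝ) :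
    spectralMap hρ f - spectralMap hρ g = spectralMap hρ (fun x => f x - g x) := by
  simp only [spectralMap, ← Matrix.sub_mul, ← Matrix.mul_sub, Matrix.diagonal_sub,
    Complex.ofReal_sub]

lemma spectralMap_trace {ρ : Matrix n n ℂ} (hρ : ρ.IsHermitian) (f : ℝ → ℝ) :
    (spectralMap hρ f).trace = ((∑ i, f (hρ.eigenvalues i) : ℝ) : ℂ) := by
  rw [spectralMap, Matrix.trace_mul_comm, ← Matrix.mul_assoc]
  simp [Matrix.trace_diagonal]

lemma conj_le_conj {A B : Matrix m m ℂ} (h : A ≤ B) (C : Matrix k m ℂ) :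
    C * A * Cᴴ ≤ C * B * Cᴴ := by
  rw [Matrix.le_iff] at h ⊢
  have := h.mul_mul_conjTranspose_same C
  rwa [Matrix.mul_sub, Matrix.sub_mul] at this

lemma conjTranspose_conj_le_conj {A B : Matrix m m ℂ} (h : A ≤ B) (C : Matrix m k ℂ) :
    Cᴴ * A * C ≤ Cᴴ * B * C := by
  simpa using conj_le_conj h Cᴴ

/-- The indicator function of `x ≠ 0`, arising as `x ^ p * x ^ (-p)`. -/
def suppInd (x : ℝ) : ℝ := if x = 0 then 0 else 1

lemma suppInd_eq {x : ℝ} (hx : 0 ≤ x) :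
    x ^ (1 / 2 : ℝ) * x ^ (-(1 / 2) : ℝ) = suppInd x := by
  rcases hx.eq_or_lt with h | h
  · subst h; simp [suppInd]
  · rw [← Real.rpow_add h]; simp [suppInd, h.ne']

lemma sqrt_mul_sqrt {ρ : Matrix n n ℂ} (hρ : ρ.PosSemidef) :
    mpow ρ (1 / 2 : ℝ) * mpow ρ (1 / 2 : ℝ) = ρ := by
  rw [mpow_eq_spectralMap hρ.1, spectralMap_mul]
  conv_rhs => rw [← spectralMap_id hρ.1]
  refine spectralMap_congr hρ fun x hx => ?_
  rw [← Real.sqrt_eq_rpow, Real.mul_self_sqrt hx]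

lemma mpow_conjTranspose {ρ : Matrix n n ℂ} (hρ : ρ.PosSemidef) (p : ℝ) :
    (mpow ρ p)ᴴ = mpow ρ p := by
  rw [mpow_eq_spectralMap hρ.1, spectralMap_conjTranspose]

lemma suppInd_le_one {ρ : Matrix n n ℂ} (hρ : ρ.IsHermitian) :
    spectralMap hρ suppInd ≤ 1 := by
  rw [Matrix.le_iff]
  have h : 1 - spectralMap hρ suppInd
      = (spectralMap hρ (fun x => 1 - suppInd x)) * (spectralMap hρ (fun x => 1 - suppInd x))ᴴ := by
    rw [spectralMap_conjTranspose, spectralMap_mul, ← spectralMap_one hρ, spectralMap_sub]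
    congr 1
    funext x
    by_cases hx : x = 0 <;> simp [suppInd, hx]
  rw [h]
  exact Matrix.posSemidef_self_mul_conjTranspose _

lemma invSqrt_conj {ρ : Matrix n n ℂ} (hρ : ρ.PosSemidef) :
    mpow ρ (-(1 / 2) : ℝ) * ρ * mpow ρ (-(1 / 2) : ℝ) = spectralMap hρ.1 suppInd := by
  have e : mpow ρ (-(1 / 2) : ℝ) * ρ * mpow ρ (-(1 / 2) : ℝ) =
      spectralMap hρ.1 (fun x => x ^ (-(1 / 2) : ℝ)) * spectralMap hρ.1 (fun x => x) *
        spectralMap hρ.1 (fun x => x ^ (-(1 / 2) : ℝ)) := by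
    rw [mpow_eq_spectralMap hρ.1, spectralMap_id]
  rw [e, spectralMap_mul, spectralMap_mul]
  refine spectralMap_congr hρ fun x hx => ?_
  rcases hx.eq_or_lt with h | h
  · subst h; simp [suppInd]
  · nth_rewrite 2 [← Real.rpow_one x]
    rw [← Real.rpow_add h, ← Real.rpow_add h]
    norm_num [suppInd, h.ne']

/-- Douglas factorization through the square root of a positive semidefinite matrix. -/
lemma exists_sqrt_factor {ρ : Matrix n n ℂ} (hρ : ρ.PosSemidef) (T : Matrix n k ℂ)
    (hT : T * Tᴴ ≤ ρ) :
    ∃ W : Matrix n k ℂ, W * Wᴴ ≤ 1 ∧ mpow ρ (1 / 2 : ℝ) * W = T ∧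
      (T * Tᴴ = ρ → mpow ρ (1 / 2 : ℝ) * (W * Wᴴ) = mpow ρ (1 / 2 : ℝ)) := by
  set r := mpow ρ (-(1 / 2) : ℝ) with hr
  have hrH : rᴴ = r := mpow_conjTranspose hρ _
  have hWW : (r * T) * (r * T)ᴴ = r * (T * Tᴴ) * rᴴ := by
    rw [Matrix.conjTranspose_mul]; simp only [Matrix.mul_assoc]
  refine ⟨r * T, ?_, ?_, ?_⟩
  · rw [hWW]
    refine (conj_le_conj hT r).trans ?_
    rw [hrH, invSqrt_conj hρ]
    exact suppInd_le_one hρ.1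
  · have hI : mpow ρ (1 / 2 : ℝ) * r = spectralMap hρ.1 suppInd := by
      rw [hr, mpow_eq_spectralMap hρ.1, mpow_eq_spectralMap hρ.1, spectralMap_mul]
      exact spectralMap_congr hρ fun x hx => suppInd_eq hx
    rw [← Matrix.mul_assoc, hI]
    set N := 1 - spectralMap hρ.1 suppInd with hN
    have hN' : N = spectralMap hρ.1 (fun x => 1 - suppInd x) := by
      rw [hN, ← spectralMap_one hρ.1, spectralMap_sub]
    have hNρ : N * ρ * Nᴴ = 0 := by
      have : N * ρ = 0 := by
        calc N * ρ = spectralMap hρ.1 (fun x => 1 - suppInd x) * spectralMap hρ.1 (fun x => x) := by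
              rw [hN', spectralMap_id]
          _ = spectralMap hρ.1 (fun _ => 0) := by
              rw [spectralMap_mul]
              congr 1
              funext x
              by_cases hx : x = 0 <;> simp [suppInd, hx]
          _ = 0 := by simp [spectralMap]
      rw [this, Matrix.zero_mul]
    have h0 : (N * T) * (N * T)ᴴ = 0 := by
      apply le_antisymm
      · rw [← hNρ, Matrix.conjTranspose_mul]
        have := conj_le_conj hT N
        simpa only [Matrix.mul_assoc] using this
      · rw [Matrix.nonneg_iff_posSemidef]
        exact Matrix.posSemidef_self_mul_conjTranspose _
    have h1 : N * T = 0 := Matrix.self_mul_conjTranspose_eq_zero.1 h0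
    rw [hN, Matrix.sub_mul, Matrix.one_mul, sub_eq_zero] at h1
    exact h1.symm
  · intro h
    rw [hWW, h, hrH, invSqrt_conj hρ, mpow_eq_spectralMap hρ.1, spectralMap_mul]
    refine spectralMap_congr hρ fun x hx => ?_
    by_cases hx : x = 0 <;> simp [suppInd, hx]

lemma conjTranspose_mul_self_le_one [DecidableEq k] {W : Matrix n k ℂ} (h : W * Wᴴ ≤ 1) :
    Wᴴ * W ≤ 1 := by
  have h1 := conjTranspose_conj_le_conj h W
  rw [Matrix.le_iff] at h1 ⊢
  have h2 := Matrix.posSemidef_self_mul_conjTranspose (1 - Wᴴ * W)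
  have e : (1 - Wᴴ * W)ᴴ = 1 - Wᴴ * W := by
    simp [Matrix.conjTranspose_sub, Matrix.conjTranspose_mul]
  have key : 1 - Wᴴ * W =
      (1 - Wᴴ * W) * (1 - Wᴴ * W)ᴴ + (Wᴴ * (1 : Matrix n n ℂ) * W - Wᴴ * (W * Wᴴ) * W) := by
    rw [e, Matrix.sub_mul, Matrix.mul_sub, Matrix.mul_sub]
    simp only [Matrix.one_mul, Matrix.mul_one, Matrix.mul_assoc]
    abel
  have h3 := h2.add h1
  exact key ▸ h3

lemma contraction_mul {W : Matrix m n ℂ} {V : Matrix n k ℂ} [DecidableEq m]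
    (hW : W * Wᴴ ≤ 1) (hV : V * Vᴴ ≤ 1) : (W * V) * (W * V)ᴴ ≤ 1 := by
  have := conj_le_conj hV W
  rw [Matrix.conjTranspose_mul]
  calc W * V * (Vᴴ * Wᴴ) = W * (V * Vᴴ) * Wᴴ := by simp only [Matrix.mul_assoc]
    _ ≤ W * 1 * Wᴴ := this
    _ ≤ 1 := by simpa using hW

lemma posSemidef_gram {p : Type*} [Finite p] (M : Matrix m p ℂ) : (Mᴴ * M).PosSemidef :=
  Matrix.posSemidef_conjTranspose_mul_self M

lemma traceNorm_eq (M : Matrix n n ℂ) :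
    traceNorm M = ∑ i, Real.sqrt ((posSemidef_gram M).1.eigenvalues i) := by
  rw [traceNorm, mpow_eq_spectralMap (posSemidef_gram M).1, spectralMap_trace, Complex.ofReal_re]
  simp only [Real.sqrt_eq_rpow]

lemma traceNorm_nonneg (M : Matrix n n ℂ) : 0 ≤ traceNorm M := by
  rw [traceNorm_eq]
  exact Finset.sum_nonneg fun i _ => Real.sqrt_nonneg _

lemma norm_sum_mul_le_sqrt (a b : k → ℂ) :
    ‖∑ i, a i * b i‖ ≤ Real.sqrt (∑ i, ‖a i‖ ^ 2) * Real.sqrt (∑ i, ‖b i‖ ^ 2) := by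
  refine (norm_sum_le _ _).trans ?_
  simp only [norm_mul]
  exact Real.sum_mul_le_sqrt_mul_sqrt _ _ _

lemma mul_conjTranspose_diag {p : Type*} (A : Matrix p m ℂ) (i : p) :
    (A * Aᴴ) i i = ((∑ j, ‖A i j‖ ^ 2 : ℝ) : ℂ) := by
  simp only [Matrix.mul_apply, Matrix.conjTranspose_apply]
  push_cast
  refine Finset.sum_congr rfl fun j _ => ?_
  simp [Complex.mul_conj, Complex.normSq_eq_norm_sq]

/-- Hölder's inequality between the operator norm and the trace norm. -/
lemma re_trace_mul_le_traceNorm (C M : Matrix n n ℂ) (hC : C * Cᴴ ≤ 1) :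
    (C * M).trace.re ≤ traceNorm M := by
  set h := (posSemidef_gram M).1 with hh
  set U : Matrix n n ℂ := (h.eigenvectorUnitary : Matrix n n ℂ) with hU
  have hUU : U * Uᴴ = 1 := by
    rw [← Matrix.star_eq_conjTranspose, hU]; simp
  have hUU' : Uᴴ * U = 1 := by
    rw [← Matrix.star_eq_conjTranspose, hU]; simp
  have htr : (C * M).trace = ((Uᴴ * C) * (M * U)).trace := by
    calc (C * M).trace = (C * M * (U * Uᴴ)).trace := by rw [hUU, Matrix.mul_one]
      _ = (Uᴴ * (C * M * U)).trace := by
        rw [← Matrix.mul_assoc, Matrix.trace_mul_comm]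
      _ = _ := by simp only [Matrix.mul_assoc]
  have hUC : (Uᴴ * C) * (Uᴴ * C)ᴴ ≤ 1 :=
    contraction_mul (by rw [Matrix.conjTranspose_conjTranspose, hUU']) hC
  have hMU : (M * U)ᴴ * (M * U) = Matrix.diagonal (fun i => ((h.eigenvalues i : ℝ) : ℂ)) := by
    have h1 := spectralMap_id h
    rw [Matrix.conjTranspose_mul]
    calc Uᴴ * Mᴴ * (M * U) = Uᴴ * (Mᴴ * M) * U := by simp only [Matrix.mul_assoc]
      _ = Uᴴ * spectralMap h (fun x => x) * U := by rw [h1]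
      _ = (Uᴴ * U) * Matrix.diagonal (fun i => ((h.eigenvalues i : ℝ) : ℂ)) * (Uᴴ * U) := by
        simp only [spectralMap, Matrix.mul_assoc, Matrix.star_eq_conjTranspose, ← hU]
      _ = _ := by rw [hUU']; simp
  rw [htr, traceNorm_eq, Matrix.trace, Complex.re_sum]
  refine Finset.sum_le_sum fun i _ => (Complex.re_le_norm _).trans ?_
  rw [Matrix.diag_apply, Matrix.mul_apply]
  refine (norm_sum_mul_le_sqrt _ _).trans ?_
  have e1 : (∑ j, ‖(Uᴴ * C) i j‖ ^ 2) ≤ 1 := by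
    rw [Matrix.le_iff] at hUC
    have := hUC.diag_nonneg (i := i)
    rw [Matrix.sub_apply, mul_conjTranspose_diag, Matrix.one_apply_eq] at this
    have h2 := (sub_nonneg.1 this)
    exact_mod_cast h2
  have e2 : (∑ j, ‖(M * U) j i‖ ^ 2) = h.eigenvalues i := by
    have h1 := mul_conjTranspose_diag (M * U)ᴴ i
    rw [Matrix.conjTranspose_conjTranspose, hMU, Matrix.diagonal_apply_eq] at h1
    have h2 := (Complex.ofReal_injective h1).symm
    simpa using h2
  rw [e2]
  calc _ ≤ 1 * Real.sqrt (h.eigenvalues i) := by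
        gcongr
        exact Real.sqrt_le_one.2 e1
    _ = _ := one_mul _

lemma exists_contraction_trace_eq (M : Matrix n n ℂ) :
    ∃ C : Matrix n n ℂ, C * Cᴴ ≤ 1 ∧ (C * M).trace = (traceNorm M : ℂ) := by
  have hG := posSemidef_gram M
  refine ⟨mpow (Mᴴ * M) (-(1 / 2) : ℝ) * Mᴴ, ?_, ?_⟩
  · rw [Matrix.conjTranspose_mul, Matrix.conjTranspose_conjTranspose, mpow_conjTranspose hG]
    calc _ = mpow (Mᴴ * M) (-(1 / 2) : ℝ) * (Mᴴ * M) * mpow (Mᴴ * M) (-(1 / 2) : ℝ) := by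
          simp only [Matrix.mul_assoc]
      _ ≤ 1 := by
          rw [invSqrt_conj hG]
          exact suppInd_le_one hG.1
  · rw [Matrix.mul_assoc, mpow_eq_spectralMap hG.1, traceNorm_eq]
    conv_lhs => enter [1, 2]; rw [← spectralMap_id hG.1]
    rw [spectralMap_mul, spectralMap_trace]
    congr 1
    refine Finset.sum_congr rfl fun i _ => ?_
    have hx := hG.eigenvalues_nonneg i
    rcases hx.eq_or_lt with h | h
    · rw [← h]; simp
    · rw [Real.sqrt_eq_rpow, ← Real.rpow_add_one h.ne']; norm_num

/-- Uhlmann's theorem: every purification `Ψ` of `ρ` has a subnormalized partner on the same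
purifying system whose overlap is the root fidelity. -/
lemma exists_uhlmann_partner {ρ' ρ : Matrix n n ℂ} (hρ' : ρ'.PosSemidef) (hρ : ρ.PosSemidef)
    (Ψ : Matrix n k ℂ) (hΨ : Ψ * Ψᴴ = ρ) :
    ∃ Φ : Matrix n k ℂ, Φ * Φᴴ ≤ ρ' ∧
      (Ψᴴ * Φ).trace = (traceNorm (mpow ρ' (1 / 2 : ℝ) * mpow ρ (1 / 2 : ℝ)) : ℂ) := by
  classical
  obtain ⟨V, hV, hsV, hsVV⟩ := exists_sqrt_factor hρ Ψ hΨ.le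
  obtain ⟨C, hC, hCt⟩ := exists_contraction_trace_eq (mpow ρ' (1 / 2 : ℝ) * mpow ρ (1 / 2 : ℝ))
  set s' := mpow ρ' (1 / 2 : ℝ)
  set s := mpow ρ (1 / 2 : ℝ)
  have hs' : s'ᴴ = s' := mpow_conjTranspose hρ' _
  have hs : sᴴ = s := mpow_conjTranspose hρ _
  have hCV : (Cᴴ * V) * (Cᴴ * V)ᴴ ≤ 1 :=
    contraction_mul (by simpa using conjTranspose_mul_self_le_one hC) hV
  refine ⟨s' * (Cᴴ * V), ?_, ?_⟩
  · have := conj_le_conj hCV s'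
    rw [Matrix.mul_one, hs', sqrt_mul_sqrt hρ'] at this
    rw [Matrix.conjTranspose_mul, hs']
    simpa only [Matrix.mul_assoc] using this
  · have h1 : (V * Vᴴ) * s = s := by
      have := congrArg Matrix.conjTranspose (hsVV hΨ)
      simpa only [Matrix.conjTranspose_mul, Matrix.conjTranspose_conjTranspose, hs] using this
    have h2 : (Ψᴴ * (s' * (Cᴴ * V))).trace = ((C * (s' * s))ᴴ).trace := by
      rw [← hsV]
      calc _ = (Vᴴ * (s * s' * Cᴴ * V)).trace := by
            simp only [Matrix.conjTranspose_mul, hs, Matrix.mul_assoc]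
        _ = (((V * Vᴴ) * s) * s' * Cᴴ).trace := by
            rw [Matrix.trace_mul_comm, Matrix.mul_assoc _ V, Matrix.trace_mul_comm]
            simp only [Matrix.mul_assoc]
        _ = _ := by
            rw [h1]; simp only [Matrix.conjTranspose_mul, hs, hs']
    rw [h2, Matrix.trace_conjTranspose, hCt]
    simp

lemma re_trace_le_traceNorm_sqrt {ρ' ρ : Matrix n n ℂ} (hρ' : ρ'.PosSemidef) (hρ : ρ.PosSemidef)
    (T Ψ : Matrix n k ℂ) (hT : T * Tᴴ ≤ ρ') (hΨ : Ψ * Ψᴴ ≤ ρ) :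
    (Tᴴ * Ψ).trace.re ≤ traceNorm (mpow ρ' (1 / 2 : ℝ) * mpow ρ (1 / 2 : ℝ)) := by
  classical
  obtain ⟨W, hW, hsW, -⟩ := exists_sqrt_factor hρ' T hT
  obtain ⟨V, hV, hsV, -⟩ := exists_sqrt_factor hρ Ψ hΨ
  have hc : (V * Wᴴ) * (V * Wᴴ)ᴴ ≤ 1 :=
    contraction_mul hV (by simpa using conjTranspose_mul_self_le_one hW)
  have := re_trace_mul_le_traceNorm _ (mpow ρ' (1 / 2 : ℝ) * mpow ρ (1 / 2 : ℝ)) hc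
  convert this using 2
  rw [← hsW, ← hsV, Matrix.conjTranspose_mul, mpow_conjTranspose hρ', Matrix.mul_assoc V,
    Matrix.trace_mul_comm V]
  simp only [Matrix.mul_assoc]

end SpectralCalculus

section Channels

open scoped MatrixOrder

lemma le_of_sub_eq {X : Type*} [Fintype X] {M N K : Matrix X X ℂ} (hK : K.PosSemidef)
    (h : N - M = K) : M ≤ N := by
  rw [Matrix.le_iff]
  exact h ▸ hK

lemma lext_posSemidef {R X Y : Type*} [Fintype R] [Fintype X] [Fintype Y]
    {Φ : Matrix X X ℂ →ₗ[ℂ] Matrix Y Y ℂ} (hΦ : IsCPTP Φ)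
    {M : Matrix (R × X) (R × X) ℂ} (hM : M.PosSemidef) : (lext Φ M).PosSemidef := by
  let e := Fintype.equivFin R
  exact (hΦ.cp _ _ (hM.submatrix (Prod.map e.symm id))).submatrix (Prod.map e id) |> fun h => by
    convert h using 1
    ext p q
    simp [lext]

lemma lext_mono {R X Y : Type*} [Fintype R] [Fintype X] [Fintype Y]
    {Φ : Matrix X X ℂ →ₗ[ℂ] Matrix Y Y ℂ} (hΦ : IsCPTP Φ)
    {M N : Matrix (R × X) (R × X) ℂ} (h : M ≤ N) : lext Φ M ≤ lext Φ N := by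
  rw [Matrix.le_iff] at h ⊢
  rw [← map_sub]
  exact lext_posSemidef hΦ h

lemma channel_posSemidef {X Y : Type*} [Fintype X] [Fintype Y]
    {Φ : Matrix X X ℂ →ₗ[ℂ] Matrix Y Y ℂ} (hΦ : IsCPTP Φ)
    {M : Matrix X X ℂ} (hM : M.PosSemidef) : (Φ M).PosSemidef :=
  (lext_posSemidef (R := Unit) hΦ (hM.submatrix Prod.snd)).submatrix (fun y => ((), y))

lemma lext_trace {R X Y : Type*} [Fintype R] [Fintype X] [Fintype Y]
    {Φ : Matrix X X ℂ →ₗ[ℂ] Matrix Y Y ℂ} (hΦ : IsCPTP Φ)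
    (M : Matrix (R × X) (R × X) ℂ) : (lext Φ M).trace = M.trace := by
  simp only [Matrix.trace, Fintype.sum_prod_type, Matrix.diag_apply]
  refine Finset.sum_congr rfl fun r _ => ?_
  exact hΦ.tp (Matrix.of fun a a' => M (r, a) (r, a'))

lemma lext_one_kronecker {R X Y : Type*} [DecidableEq R]
    (Φ : Matrix X X ℂ →ₗ[ℂ] Matrix Y Y ℂ) (M : Matrix X X ℂ) :
    lext Φ ((1 : Matrix R R ℂ) ⊗ₖ M) = (1 : Matrix R R ℂ) ⊗ₖ Φ M := by
  ext p q
  have : (Matrix.of fun a a' => ((1 : Matrix R R ℂ) ⊗ₖ M) (p.1, a) (q.1, a'))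
      = (1 : Matrix R R ℂ) p.1 q.1 • M := by
    ext a a'; simp
  change Φ (Matrix.of fun a a' => ((1 : Matrix R R ℂ) ⊗ₖ M) (p.1, a) (q.1, a')) p.2 q.2 = _
  rw [this, map_smul, Matrix.smul_apply, smul_eq_mul, Matrix.kroneckerMap_apply]

lemma trace_reindex {X Y : Type*} [Fintype X] [Fintype Y] (e : X ≃ Y) (M : Matrix X X ℂ) :
    (Matrix.reindex e e M).trace = M.trace := by
  simp only [Matrix.trace, Matrix.diag_apply, Matrix.reindex_apply, Matrix.submatrix_apply]
  exact e.symm.sum_comp (fun x => M x x)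

lemma traceOut_posSemidef {X Y Z : Type*} [Fintype Z] (e : X ≃ Y × Z) {M : Matrix X X ℂ}
    (hM : M.PosSemidef) : (traceOut e M).PosSemidef := by
  have : traceOut e M = ∑ z, M.submatrix (fun y => e.symm (y, z)) (fun y => e.symm (y, z)) := by
    ext y y'
    simp [traceOut, Matrix.sum_apply]
  rw [this]
  exact Matrix.posSemidef_sum _ fun z _ => hM.submatrix _

lemma traceOut_mono {X Y Z : Type*} [Fintype X] [Fintype Y] [Fintype Z] (e : X ≃ Y × Z)
    {M N : Matrix X X ℂ} (h : M ≤ N) : traceOut e M ≤ traceOut e N := by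
  refine le_of_sub_eq (traceOut_posSemidef e (Matrix.le_iff.1 h)) ?_
  ext y y'
  simp [traceOut, Finset.sum_sub_distrib]

lemma traceOut_trace {X Y Z : Type*} [Fintype X] [Fintype Y] [Fintype Z] (e : X ≃ Y × Z)
    (M : Matrix X X ℂ) : (traceOut e M).trace = M.trace := by
  simp only [Matrix.trace, Matrix.diag_apply, traceOut, Matrix.of_apply,
    ← Fintype.sum_prod_type (f := fun z => M (e.symm z) (e.symm z))]
  exact e.symm.sum_comp (fun x => M x x)

lemma submatrix_mono {X Y : Type*} [Fintype X] [Fintype Y] {M N : Matrix X X ℂ} (h : M ≤ N)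
    (f : Y → X) : M.submatrix f f ≤ N.submatrix f f := by
  rw [Matrix.le_iff] at h ⊢
  exact h.submatrix f

lemma kronecker_mono_left {X Y : Type*} [Fintype X] [Fintype Y] {M N : Matrix X X ℂ}
    (h : M ≤ N) {D : Matrix Y Y ℂ} (hD : D.PosSemidef) : M ⊗ₖ D ≤ N ⊗ₖ D := by
  classical
  refine le_of_sub_eq ((Matrix.le_iff.1 h).kronecker hD) ?_
  ext i j
  simp [sub_mul]

lemma real_smul_mono {X : Type*} [Fintype X] {M N : Matrix X X ℂ} (h : M ≤ N) {c : ℝ}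
    (hc : 0 ≤ c) : c • M ≤ c • N := by
  rw [Matrix.le_iff] at h ⊢
  rw [← smul_sub]
  exact h.smul hc

lemma pinch2_le_kronecker {R Q : Type*} [Fintype R] [Fintype Q] [DecidableEq Q]
    {N : Matrix (R × Q) (R × Q) ℂ} (hN : N.PosSemidef) :
    pinch2 N ≤ ptB N ⊗ₖ (1 : Matrix Q Q ℂ) := by
  classical
  let B : Q → Matrix R R ℂ := fun q => N.submatrix (fun r => (r, q)) (fun r => (r, q))
  have hB : ∀ q, (ptB N - B q).PosSemidef := by
    intro q
    have : ptB N - B q = ∑ q' ∈ Finset.univ.erase q, B q' := by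
      rw [sub_eq_iff_eq_add, Finset.sum_erase_add _ _ (Finset.mem_univ q)]
      ext r r'
      simp [ptB, B, Matrix.sum_apply]
    rw [this]
    exact Matrix.posSemidef_sum _ fun q' _ => hN.submatrix _
  have hE : ∀ q : Q, (Matrix.diagonal (Pi.single q (1 : ℂ))).PosSemidef := fun q =>
    Matrix.PosSemidef.diagonal (Pi.single_nonneg.2 zero_le_one)
  refine le_of_sub_eq (Matrix.posSemidef_sum Finset.univ fun q _ => (hB q).kronecker (hE q)) ?_
  ext ⟨r, x⟩ ⟨r', y⟩
  by_cases hxy : x = y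
  · subst hxy
    simp [Matrix.sum_apply, pinch2, B, Pi.single_apply]
  · simp [Matrix.sum_apply, pinch2, B, hxy]

lemma le_card_smul_pinch2 {R Q : Type*} [Fintype R] [Fintype Q] [DecidableEq Q]
    {N : Matrix (R × Q) (R × Q) ℂ} (hN : N.PosSemidef) :
    N ≤ (Fintype.card Q : ℝ) • pinch2 N := by
  classical
  let D : Q → Q → Matrix (R × Q) (R × Q) ℂ := fun q q' =>
    Matrix.diagonal fun x => (if x.2 = q then 1 else 0) - (if x.2 = q' then 1 else 0)
  have key : (Fintype.card Q : ℝ) • pinch2 N - N =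
      (1 / 2 : ℝ) • ∑ q, ∑ q', D q q' * N * (D q q')ᴴ := by
    ext ⟨r, x⟩ ⟨r', y⟩
    have hD : ∀ q q', (D q q' * N * (D q q')ᴴ) (r, x) (r', y) =
        (((if x = q then 1 else 0) - (if x = q' then 1 else 0)) *
        ((if y = q then 1 else 0) - (if y = q' then 1 else 0))) * N (r, x) (r', y) := by
      intro q q'
      simp only [D, Matrix.diagonal_conjTranspose, Matrix.mul_diagonal,
        Matrix.diagonal_mul, Pi.star_apply, star_sub]
      have : ∀ p : Prop, [Decidable p] → star (if p then (1 : ℂ) else 0) = if p then 1 else 0 := by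
        intro p _; split_ifs <;> simp
      rw [this, this]
      ring
    simp only [Matrix.sub_apply, Matrix.smul_apply, Matrix.sum_apply, hD, ← Finset.sum_mul]
    have hs : (∑ q, ∑ q', (((if x = q then 1 else 0) - (if x = q' then 1 else 0)) *
        ((if y = q then 1 else 0) - (if y = q' then 1 else 0))) : ℂ) =
        2 * (Fintype.card Q * (if x = y then 1 else 0)) - 2 := by
      simp only [sub_mul, mul_sub, Finset.sum_sub_distrib, Finset.sum_const, Finset.card_univ,
        ← Finset.sum_mul, ← Finset.mul_sum, nsmul_eq_mul]
      simp
      by_cases hxy : x = y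
      · subst hxy; simp; ring
      · simp [hxy]; ring
    rw [hs]
    simp only [pinch2, Matrix.of_apply, Complex.real_smul]
    push_cast
    split_ifs <;> ring
  rw [Matrix.le_iff]
  exact key ▸ (Matrix.posSemidef_sum _ fun q _ => Matrix.posSemidef_sum _ fun q' _ =>
    hN.mul_mul_conjTranspose_same _).smul (by norm_num : (0:ℝ) ≤ 1 / 2)

end Channels

section Vectors

open scoped MatrixOrder

/-- A vector on `Y × Z`, regarded as a matrix from `Z` to `Y`. -/
def bipartiteMatrix {X Y Z : Type*} (e : X ≃ Y × Z) (ψ : X → ℂ) : Matrix Y Z ℂ :=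
  Matrix.of fun y z => ψ (e.symm (y, z))

variable {X Y Z : Type*} [Fintype X] [Fintype Y] [Fintype Z]

lemma pureState_posSemidef (ψ : X → ℂ) : (pureState ψ).PosSemidef :=
  Matrix.posSemidef_vecMulVec_self_star ψ

lemma trace_pureState (ψ : X → ℂ) : (pureState ψ).trace = star ψ ⬝ᵥ ψ := by
  rw [pureState, Matrix.trace_vecMulVec, dotProduct_comm]

lemma bipartiteMatrix_mul_conjTranspose {X Y Z : Type*} [Fintype Z] (e : X ≃ Y × Z) (ψ : X → ℂ) :
    bipartiteMatrix e ψ * (bipartiteMatrix e ψ)ᴴ = traceOut e (pureState ψ) := by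
  ext y y'
  simp [bipartiteMatrix, Matrix.mul_apply, traceOut, pureState, Matrix.vecMulVec_apply]

lemma bipartiteMatrix_inner (e : X ≃ Y × Z) (ψ φ : X → ℂ) :
    ((bipartiteMatrix e ψ)ᴴ * bipartiteMatrix e φ).trace = star ψ ⬝ᵥ φ := by
  simp only [Matrix.trace, Matrix.diag_apply, Matrix.mul_apply, bipartiteMatrix,
    Matrix.conjTranspose_apply, Matrix.of_apply, dotProduct, Pi.star_apply]
  rw [Finset.sum_comm, ← Fintype.sum_prod_type (f := fun z => star (ψ (e.symm z)) * φ (e.symm z))]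
  exact e.symm.sum_comp (fun x => star (ψ x) * φ x)

lemma exists_bipartiteMatrix_eq {X Y Z : Type*} (e : X ≃ Y × Z) (Φ : Matrix Y Z ℂ) :
    ∃ φ, bipartiteMatrix e φ = Φ :=
  ⟨fun x => Φ (e x).1 (e x).2, by ext; simp [bipartiteMatrix]⟩

lemma pureState_mul_pureState {ψ : X → ℂ} (hψ : star ψ ⬝ᵥ ψ = 1) :
    pureState ψ * pureState ψ = pureState ψ := by
  rw [pureState, Matrix.vecMulVec_mul_vecMulVec, hψ, one_smul]

lemma pureState_le_one [DecidableEq X] {ψ : X → ℂ} (hψ : star ψ ⬝ᵥ ψ = 1) :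
    pureState ψ ≤ 1 := by
  have hH : (1 - pureState ψ)ᴴ = 1 - pureState ψ := by
    rw [Matrix.conjTranspose_sub, Matrix.conjTranspose_one, (pureState_posSemidef ψ).1]
  refine le_of_sub_eq (Matrix.posSemidef_self_mul_conjTranspose (1 - pureState ψ)) ?_
  rw [hH, Matrix.sub_mul, Matrix.mul_sub, Matrix.mul_sub, pureState_mul_pureState hψ]
  simp

lemma re_trace_mul_nonneg {M N : Matrix X X ℂ} (hM : M.PosSemidef) (hN : N.PosSemidef) :
    0 ≤ (M * N).trace.re := by
  classical
  have h1 : (M * N).trace = (mpow N (1 / 2 : ℝ) * M * (mpow N (1 / 2 : ℝ))ᴴ).trace := by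
    conv_lhs => rw [← sqrt_mul_sqrt hN]
    rw [mpow_conjTranspose hN, ← Matrix.mul_assoc, Matrix.trace_mul_comm, Matrix.mul_assoc]
  rw [h1]
  exact (Complex.le_def.1 (hM.mul_mul_conjTranspose_same _).trace_nonneg).1

/-- Cauchy–Schwarz for a functional that is positive on pure states. -/
lemma re_functional_le_sqrt {X : Type*} (F : Matrix X X ℂ →ₗ[ℂ] ℂ)
    (hF : ∀ x : X → ℂ, 0 ≤ (F (pureState x)).re) (ψ φ : X → ℂ) :
    (F (Matrix.vecMulVec φ (star ψ) + Matrix.vecMulVec ψ (star φ))).re ≤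
      2 * (Real.sqrt (F (pureState φ)).re * Real.sqrt (F (pureState ψ)).re) := by
  set b := (F (Matrix.vecMulVec φ (star ψ) + Matrix.vecMulVec ψ (star φ))).re with hb
  set a := (F (pureState φ)).re
  set c := (F (pureState ψ)).re
  have hquad : ∀ t : ℝ, 0 ≤ a * (t * t) + b * t + c := by
    intro t
    have h := hF ((t : ℂ) • φ + ψ)
    have e : pureState ((t : ℂ) • φ + ψ) = ((t * t : ℝ) : ℂ) • pureState φ +
        (t : ℂ) • (Matrix.vecMulVec φ (star ψ) + Matrix.vecMulVec ψ (star φ)) + pureState ψ := by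
      ext i j
      simp [pureState, Matrix.vecMulVec_apply]
      ring
    rw [e, map_add, map_add, map_smul, map_smul] at h
    simp only [Complex.add_re, smul_eq_mul, Complex.re_ofReal_mul] at h
    linarith
  have hd := discrim_le_zero hquad
  rw [discrim] at hd
  have ha : 0 ≤ a := hF φ
  rw [← Real.sqrt_mul ha]
  have : b / 2 ≤ Real.sqrt (a * c) := Real.le_sqrt_of_sq_le (by nlinarith)
  linarith

/-- Trigonometric triangle inequality for the sine metric, in algebraic form. -/
lemma one_sub_le_sq_add {g h c u ε δ : ℝ} (hg : 0 ≤ g) (hu : g ≤ u) (hu1 : u ≤ 1) (hh1 : h ≤ 1)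
    (hε : 0 ≤ ε) (hδ : 0 ≤ δ) (hc0 : 0 ≤ c) (hc : 1 - c ^ 2 ≤ ε ^ 2) (hhδ : 1 - h ≤ δ ^ 2)
    (hh0 : 0 ≤ h)
    (hb : c ≤ Real.sqrt g * Real.sqrt h + Real.sqrt (u - g) * Real.sqrt (1 - h)) :
    1 - g ≤ (ε + δ) ^ 2 := by
  have hb' : c ≤ Real.sqrt g * Real.sqrt h + Real.sqrt (1 - g) * Real.sqrt (1 - h) := by
    refine hb.trans ?_
    gcongr
  have hg1 : g ≤ 1 := hu.trans hu1
  set p := Real.sqrt g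
  set q := Real.sqrt h
  set s := Real.sqrt (1 - g)
  set t := Real.sqrt (1 - h)
  have hp2 : p ^ 2 = g := Real.sq_sqrt hg
  have hq2 : q ^ 2 = h := Real.sq_sqrt hh0
  have hs2 : s ^ 2 = 1 - g := Real.sq_sqrt (by linarith)
  have ht2 : t ^ 2 = 1 - h := Real.sq_sqrt (by linarith)
  have hp : 0 ≤ p := Real.sqrt_nonneg _
  have hq : 0 ≤ q := Real.sqrt_nonneg _
  have hs : 0 ≤ s := Real.sqrt_nonneg _
  have ht : 0 ≤ t := Real.sqrt_nonneg _
  have htδ : t ≤ δ := abs_le_of_sq_le_sq' (by rw [ht2]; exact hhδ) hδ |>.2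
  have hq1 : q ≤ 1 := Real.sqrt_le_one.2 hh1
  set S := s * q - p * t with hS
  set C := p * q + s * t with hC
  have hSC : S ^ 2 + C ^ 2 = 1 := by
    have : S ^ 2 + C ^ 2 = (s ^ 2 + p ^ 2) * (q ^ 2 + t ^ 2) := by rw [hS, hC]; ring
    rw [this, hp2, hq2, hs2, ht2]; ring
  have hC1 : C ≤ 1 := by nlinarith [sq_nonneg S]
  have hC0 : 0 ≤ C := hc0.trans hb'
  have hSε : S ≤ ε := abs_le_of_sq_le_sq' (by nlinarith) hε |>.2
  have hs_eq : s = S * q + C * t := by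
    have : S * q + C * t = s * (q ^ 2 + t ^ 2) := by rw [hS, hC]; ring
    rw [this, hq2, ht2]; ring
  have hs_le : s ≤ ε + δ := by
    have h1 : S * q ≤ ε := (mul_le_mul_of_nonneg_right hSε hq).trans (mul_le_of_le_one_right hε hq1)
    have h2 : C * t ≤ δ := (mul_le_of_le_one_left ht hC1).trans htδ
    linarith
  rw [← hs2]
  gcongr

/-- Overlap with a pure target after a channel, when the input is perturbed. -/
lemma one_sub_overlap_le (Λ : Matrix X X ℂ →ₗ[ℂ] Matrix X X ℂ)
    (hpos : ∀ M : Matrix X X ℂ, M.PosSemidef → (Λ M).PosSemidef)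
    (htr : ∀ M : Matrix X X ℂ, (Λ M).trace = M.trace)
    {ψ φ : X → ℂ} (hψ : star ψ ⬝ᵥ ψ = 1) (hφ : (star φ ⬝ᵥ φ).re ≤ 1) {c ε δ : ℝ}
    (hc : star ψ ⬝ᵥ φ = (c : ℂ)) (hc0 : 0 ≤ c) (hcε : 1 - c ^ 2 ≤ ε ^ 2) (hε : 0 ≤ ε) (hδ : 0 ≤ δ)
    (hh : 1 - (Λ (pureState ψ) * pureState ψ).trace.re ≤ δ ^ 2) :
    1 - (Λ (pureState φ) * pureState ψ).trace.re ≤ (ε + δ) ^ 2 := by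
  classical
  let F : Matrix X X ℂ →ₗ[ℂ] ℂ :=
    (Matrix.traceLinearMap X ℂ ℂ) ∘ₗ (LinearMap.mulRight ℂ (pureState ψ)) ∘ₗ Λ
  let G : Matrix X X ℂ →ₗ[ℂ] ℂ :=
    (Matrix.traceLinearMap X ℂ ℂ) ∘ₗ (LinearMap.mulRight ℂ (1 - pureState ψ)) ∘ₗ Λ
  have hFG : ∀ M, F M + G M = M.trace := by
    intro M
    have : F M + G M = (Λ M * pureState ψ).trace + (Λ M * (1 - pureState ψ)).trace := rfl
    rw [this, ← Matrix.trace_add, ← Matrix.mul_add, add_sub_cancel, Matrix.mul_one, htr]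
  have hF : ∀ x, 0 ≤ (F (pureState x)).re := fun x =>
    re_trace_mul_nonneg (hpos _ (pureState_posSemidef x)) (pureState_posSemidef ψ)
  have hG : ∀ x, 0 ≤ (G (pureState x)).re := fun x =>
    re_trace_mul_nonneg (hpos _ (pureState_posSemidef x)) (Matrix.le_iff.1 (pureState_le_one hψ))
  have h1 := re_functional_le_sqrt F hF ψ φ
  have h2 := re_functional_le_sqrt G hG ψ φ
  have hcross : (Matrix.vecMulVec φ (star ψ) + Matrix.vecMulVec ψ (star φ)).trace
      = ((2 * c : ℝ) : ℂ) := by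
    have hc' : star φ ⬝ᵥ ψ = (c : ℂ) := by
      have := congrArg star hc
      rwa [Matrix.star_dotProduct, star_star, Complex.star_def,
        Complex.conj_ofReal] at this
    rw [Matrix.trace_add, Matrix.trace_vecMulVec, Matrix.trace_vecMulVec, dotProduct_comm, hc,
      dotProduct_comm, hc']
    push_cast; ring
  have h3 := congrArg Complex.re (hFG (Matrix.vecMulVec φ (star ψ) + Matrix.vecMulVec ψ (star φ)))
  rw [hcross, Complex.add_re, Complex.ofReal_re] at h3
  have h4 := congrArg Complex.re (hFG (pureState ψ))
  rw [trace_pureState, hψ, Complex.add_re, Complex.one_re] at h4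
  have h5 := congrArg Complex.re (hFG (pureState φ))
  rw [trace_pureState, Complex.add_re] at h5
  have e1 : (G (pureState φ)).re = (star φ ⬝ᵥ φ).re - (F (pureState φ)).re := by linarith
  have e2 : (G (pureState ψ)).re = 1 - (F (pureState ψ)).re := by linarith
  rw [e1, e2] at h2
  have hGφ := hG φ
  have hGψ := hG ψ
  exact one_sub_le_sq_add (g := (F (pureState φ)).re) (h := (F (pureState ψ)).re)
    (u := (star φ ⬝ᵥ φ).re) (hF φ) (by linarith) hφ (by linarith) hε hδ hc0 hcε hh (hF ψ)
    (by linarith)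

lemma gFid_eq_traceNorm [DecidableEq X] (ρ' : Matrix X X ℂ) {ρ : Matrix X X ℂ}
    (hρ : ρ.trace = 1) :
    gFid ρ' ρ = traceNorm (mpow ρ' (1 / 2 : ℝ) * mpow ρ (1 / 2 : ℝ)) := by
  simp [gFid, hρ]

lemma one_sub_sq_le_of_pDist_le [DecidableEq X] {ρ' ρ : Matrix X X ℂ} {ε : ℝ} (hε : 0 ≤ ε)
    (hρ : ρ.trace = 1) (h : pDist ρ' ρ ≤ ε) :
    1 - traceNorm (mpow ρ' (1 / 2 : ℝ) * mpow ρ (1 / 2 : ℝ)) ^ 2 ≤ ε ^ 2 := by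
  rw [pDist, gFid_eq_traceNorm _ hρ] at h
  exact (Real.sqrt_le_left hε).1 h

/-- Root fidelity with a pure state is at most the root of the overlap. -/
lemma traceNorm_sq_le_overlap [DecidableEq X] {ω : Matrix X X ℂ} (hω : ω.PosSemidef)
    (ψ : X → ℂ) :
    traceNorm (mpow ω (1 / 2 : ℝ) * mpow (pureState ψ) (1 / 2 : ℝ)) ^ 2 ≤
      (ω * pureState ψ).trace.re := by
  set Ψ : Matrix X Unit ℂ := Matrix.of fun x _ => ψ x with hΨ
  have hΨΨ : Ψ * Ψᴴ = pureState ψ := by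
    ext i j; simp [hΨ, Matrix.mul_apply, pureState, Matrix.vecMulVec_apply]
  obtain ⟨Φ, hΦ, htr⟩ := exists_uhlmann_partner hω (pureState_posSemidef ψ) Ψ hΨΨ
  set F := traceNorm (mpow ω (1 / 2 : ℝ) * mpow (pureState ψ) (1 / 2 : ℝ))
  have h1 := conjTranspose_conj_le_conj hΦ Ψ
  have h2 : (Ψᴴ * (Φ * Φᴴ) * Ψ).trace = ((F ^ 2 : ℝ) : ℂ) := by
    have e : Ψᴴ * (Φ * Φᴴ) * Ψ = (Ψᴴ * Φ) * (Ψᴴ * Φ)ᴴ := by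
      simp only [Matrix.conjTranspose_mul, Matrix.conjTranspose_conjTranspose, Matrix.mul_assoc]
    have hu : (Ψᴴ * Φ) () () = (F : ℂ) := by
      rw [← htr]; simp [Matrix.trace]
    rw [e, Matrix.trace]
    simp only [Finset.univ_unique, Finset.sum_singleton, Matrix.diag_apply,
      Matrix.mul_apply (M := Ψᴴ * Φ),
      Matrix.conjTranspose_apply]
    change (Ψᴴ * Φ) () () * star ((Ψᴴ * Φ) () ()) = _
    rw [hu]
    simp [sq]
  have h3 : (Ψᴴ * ω * Ψ).trace = (ω * pureState ψ).trace := by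
    rw [← hΨΨ, ← Matrix.mul_assoc, Matrix.trace_mul_comm (ω * Ψ), Matrix.mul_assoc]
  have h4 := (Complex.le_def.1 (Matrix.le_iff.1 h1).trace_nonneg).1
  rw [Matrix.trace_sub, h2, h3, Complex.sub_re, Complex.ofReal_re, Complex.zero_re] at h4
  linarith

/-- The overlap with a purification bounds the fidelity of the marginals from below. -/
lemma overlap_le_traceNorm_sq [DecidableEq X] [DecidableEq Y] (e : X ≃ Y × Z)
    {τ : Matrix X X ℂ} (hτ : τ.PosSemidef) (ψ : X → ℂ) :
    (τ * pureState ψ).trace.re ≤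
      traceNorm (mpow (traceOut e τ) (1 / 2 : ℝ) *
        mpow (traceOut e (pureState ψ)) (1 / 2 : ℝ)) ^ 2 := by
  set g := (τ * pureState ψ).trace.re with hg
  rcases le_or_gt g 0 with h0 | h0
  · exact h0.trans (sq_nonneg _)
  set N := mpow τ (1 / 2 : ℝ)
  have hNN : N * N = τ := sqrt_mul_sqrt hτ
  have hNH : Nᴴ = N := mpow_conjTranspose hτ _
  set v := N *ᵥ ψ with hv
  have hvv : star v ⬝ᵥ v = (g : ℂ) := by
    have h1 : star v ⬝ᵥ v = (τ * pureState ψ).trace := by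
      rw [hv, Matrix.star_mulVec, hNH, ← Matrix.dotProduct_mulVec, Matrix.mulVec_mulVec, hNN,
        pureState, Matrix.mul_vecMulVec, Matrix.trace_vecMulVec, dotProduct_comm]
    have h2 : (0 : ℂ) ≤ star v ⬝ᵥ v := (by
      rw [← trace_pureState]; exact (pureState_posSemidef v).trace_nonneg)
    rw [h1] at h2 ⊢
    exact Complex.ext rfl (Complex.le_def.1 h2).2.symm
  set w : X → ℂ := ((Real.sqrt g)⁻¹ : ℂ) • v with hw
  have hsg : (Real.sqrt g : ℂ) * Real.sqrt g = g := by
    rw [← Complex.ofReal_mul, Real.mul_self_sqrt h0.le]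
  have hsg0 : (Real.sqrt g : ℂ) ≠ 0 := by
    exact_mod_cast (Real.sqrt_pos.2 h0).ne'
  have hww : star w ⬝ᵥ w = 1 := by
    rw [hw, star_smul, smul_dotProduct, dotProduct_smul, hvv]
    simp only [smul_eq_mul, star_inv₀, Complex.star_def, Complex.conj_ofReal]
    rw [← hsg]
    field_simp
  have ht : pureState (N *ᵥ w) ≤ τ := by
    have h1 := conj_le_conj (pureState_le_one hww) N
    rw [Matrix.mul_one, hNH, hNN] at h1
    convert h1 using 1
    rw [pureState, pureState, Matrix.mul_vecMulVec, Matrix.vecMulVec_mul, Matrix.star_mulVec, hNH]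
  have hin : star (N *ᵥ w) ⬝ᵥ ψ = (Real.sqrt g : ℂ) := by
    rw [Matrix.star_mulVec, hNH, ← Matrix.dotProduct_mulVec, ← hv, hw, star_smul, smul_dotProduct,
      hvv, ← hsg]
    simp only [smul_eq_mul, star_inv₀, Complex.star_def, Complex.conj_ofReal]
    field_simp
  have hfin := re_trace_le_traceNorm_sqrt (traceOut_posSemidef e hτ)
    (traceOut_posSemidef e (pureState_posSemidef ψ)) (bipartiteMatrix e (N *ᵥ w))
    (bipartiteMatrix e ψ)
    (by rw [bipartiteMatrix_mul_conjTranspose]; exact traceOut_mono e ht)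
    (by rw [bipartiteMatrix_mul_conjTranspose])
  rw [bipartiteMatrix_inner, hin, Complex.ofReal_re] at hfin
  calc g = Real.sqrt g ^ 2 := (Real.sq_sqrt h0.le).symm
    _ ≤ _ := by gcongr

end Vectors

section Protocol

open scoped MatrixOrder

/-- `R × (P × Q) ≃ (R × Q) × P` (trace out `P`). -/
def eMsg (R P Q : Type*) : R × (P × Q) ≃ (R × Q) × P where
  toFun x := ((x.1, x.2.2), x.2.1)
  invFun y := (y.1.1, (y.2, y.1.2))
  left_inv _ := rfl
  right_inv _ := rfl

/-- `(S × (L × E)) × P ≃ (S × E) × (L × P)` (trace out `L` and `P`). -/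
def eSE (S L E P : Type*) : (S × (L × E)) × P ≃ (S × E) × (L × P) where
  toFun x := ((x.1.1, x.1.2.2), (x.1.2.1, x.2))
  invFun y := ((y.1.1, (y.2.1, y.1.2)), y.2.2)
  left_inv _ := rfl
  right_inv _ := rfl

variable {S L E P A' B' Q : Type*}

/-- Regroups Bob's registers together with the reference, the message register placed last. -/
def msgLast (S E B' Q : Type*) (x : S × ((Q × E) × B')) : (S × (E × B')) × Q :=
  ((x.1, (x.2.1.2, x.2.2)), x.2.1.1)

/-- The joint matrix after the encoding step. -/
def encoded (ent : Matrix (A' × B') (A' × B') ℂ)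
    (enc : Matrix ((P × L) × A') ((P × L) × A') ℂ →ₗ[ℂ] Matrix (P × Q) (P × Q) ℂ) :
    Matrix ((S × (L × E)) × P) ((S × (L × E)) × P) ℂ →ₗ[ℂ]
      Matrix ((S × (E × B')) × (P × Q)) ((S × (E × B')) × (P × Q)) ℂ where
  toFun M := lext enc (Matrix.reindex (eEnc S L E P A' B') (eEnc S L E P A' B') (M ⊗ₖ ent))
  map_add' M N := by
    rw [Matrix.add_kronecker, ← map_add]; rfl
  map_smul' c M := by
    rw [Matrix.smul_kronecker, RingHom.id_apply, ← map_smul]; rfl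

/-- The joint matrix after the decoding step, in the original register ordering. -/
def decoded
    (dec : Matrix ((Q × E) × B') ((Q × E) × B') ℂ →ₗ[ℂ] Matrix (E × L) (E × L) ℂ) :
    Matrix ((S × (E × B')) × (P × Q)) ((S × (E × B')) × (P × Q)) ℂ →ₗ[ℂ]
      Matrix ((S × (L × E)) × P) ((S × (L × E)) × P) ℂ where
  toFun N := Matrix.reindex (eFin S L E P) (eFin S L E P)
    (lext dec (Matrix.reindex (eDec S E P B' Q) (eDec S E P B' Q) N))
  map_add' M N := by
    have : Matrix.reindex (eDec S E P B' Q) (eDec S E P B' Q) (M + N) =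
      Matrix.reindex (eDec S E P B' Q) (eDec S E P B' Q) M +
      Matrix.reindex (eDec S E P B' Q) (eDec S E P B' Q) N := rfl
    rw [this, map_add]; rfl
  map_smul' c M := by
    have : Matrix.reindex (eDec S E P B' Q) (eDec S E P B' Q) (c • M) =
      c • Matrix.reindex (eDec S E P B' Q) (eDec S E P B' Q) M := rfl
    rw [this, map_smul]; rfl

variable [Fintype S] [Fintype L] [Fintype E] [Fintype P] [Fintype A'] [Fintype B'] [Fintype Q]

lemma encoded_posSemidef {ent : Matrix (A' × B') (A' × B') ℂ} (hent : IsState ent)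
    {enc : Matrix ((P × L) × A') ((P × L) × A') ℂ →ₗ[ℂ] Matrix (P × Q) (P × Q) ℂ}
    (henc : IsCPTP enc) {M : Matrix ((S × (L × E)) × P) ((S × (L × E)) × P) ℂ}
    (hM : M.PosSemidef) : (encoded ent enc M).PosSemidef := by
  classical
  exact lext_posSemidef henc ((hM.kronecker hent.1).submatrix _)

lemma encoded_trace {ent : Matrix (A' × B') (A' × B') ℂ} (hent : IsState ent)
    {enc : Matrix ((P × L) × A') ((P × L) × A') ℂ →ₗ[ℂ] Matrix (P × Q) (P × Q) ℂ}
    (henc : IsCPTP enc) (M : Matrix ((S × (L × E)) × P) ((S × (L × E)) × P) ℂ) :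
    (encoded ent enc M).trace = M.trace := by
  change (lext enc _).trace = _
  rw [lext_trace henc, trace_reindex, Matrix.trace_kronecker, hent.2, mul_one]

lemma decoded_posSemidef
    {dec : Matrix ((Q × E) × B') ((Q × E) × B') ℂ →ₗ[ℂ] Matrix (E × L) (E × L) ℂ}
    (hdec : IsCPTP dec)
    {N : Matrix ((S × (E × B')) × (P × Q)) ((S × (E × B')) × (P × Q)) ℂ}
    (hN : N.PosSemidef) : (decoded dec N).PosSemidef :=
  (lext_posSemidef hdec (hN.submatrix _)).submatrix _

lemma decoded_trace
    {dec : Matrix ((Q × E) × B') ((Q × E) × B') ℂ →ₗ[ℂ] Matrix (E × L) (E × L) ℂ}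
    (hdec : IsCPTP dec)
    (N : Matrix ((S × (E × B')) × (P × Q)) ((S × (E × B')) × (P × Q)) ℂ) :
    (decoded dec N).trace = N.trace := by
  change (Matrix.reindex _ _ (lext dec _)).trace = _
  rw [trace_reindex, lext_trace hdec, trace_reindex]

/-- Encoding does not change what Bob and the reference hold. -/
lemma ptB_traceOut_encoded {S L E P A' B' Q : Type*} [Fintype L] [Fintype P] [Fintype A']
    [Fintype Q] (ent : Matrix (A' × B') (A' × B') ℂ)
    {enc : Matrix ((P × L) × A') ((P × L) × A') ℂ →ₗ[ℂ] Matrix (P × Q) (P × Q) ℂ}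
    (henc : IsCPTP enc) (M : Matrix ((S × (L × E)) × P) ((S × (L × E)) × P) ℂ) :
    ptB (traceOut (eMsg (S × (E × B')) P Q) (encoded ent enc M)) =
      (traceOut (eSE S L E P) M ⊗ₖ ptA ent).submatrix
        (fun r => ((r.1, r.2.1), r.2.2)) (fun r => ((r.1, r.2.1), r.2.2)) := by
  ext ⟨s, e, b⟩ ⟨s', e', b'⟩
  have h := henc.tp (Matrix.of fun x y => Matrix.reindex (eEnc S L E P A' B')
    (eEnc S L E P A' B') (M ⊗ₖ ent) ((s, (e, b)), x) ((s', (e', b')), y))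
  have hl : ptB (traceOut (eMsg (S × (E × B')) P Q) (encoded ent enc M)) (s, e, b) (s', e', b') =
      (enc (Matrix.of fun x y => Matrix.reindex (eEnc S L E P A' B')
    (eEnc S L E P A' B') (M ⊗ₖ ent) ((s, (e, b)), x) ((s', (e', b')), y))).trace := by
    simp only [Matrix.trace, Fintype.sum_prod_type]
    rw [Finset.sum_comm]
    rfl
  rw [hl, h]
  simp only [Matrix.trace, Fintype.sum_prod_type, Matrix.diag_apply, Matrix.of_apply,
    Matrix.reindex_apply, Matrix.submatrix_apply, Matrix.kroneckerMap_apply, traceOut, ptA,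
    Finset.sum_mul, Finset.mul_sum]
  rw [Finset.sum_comm]
  conv_rhs => rw [Finset.sum_comm]
  refine Finset.sum_congr rfl fun l _ => ?_
  conv_rhs => rw [Finset.sum_comm]
  rfl

lemma traceOut_decoded {S L E P B' Q : Type*} [Fintype P]
    (dec : Matrix ((Q × E) × B') ((Q × E) × B') ℂ →ₗ[ℂ] Matrix (E × L) (E × L) ℂ)
    (N : Matrix ((S × (E × B')) × (P × Q)) ((S × (E × B')) × (P × Q)) ℂ) :
    traceOut (Equiv.refl _) (decoded dec N) =
      (lext dec ((traceOut (eMsg (S × (E × B')) P Q) N).submatrix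
        (msgLast S E B' Q) (msgLast S E B' Q))).submatrix
        (fun y => (y.1, (y.2.2, y.2.1))) (fun y => (y.1, (y.2.2, y.2.1))) := by
  ext ⟨s, l, e⟩ ⟨s', l', e'⟩
  let B : P → Matrix ((Q × E) × B') ((Q × E) × B') ℂ := fun p => Matrix.of fun x y =>
    N ((s, (x.1.2, x.2)), (p, x.1.1)) ((s', (y.1.2, y.2)), (p, y.1.1))
  have hl : traceOut (Equiv.refl _) (decoded dec N) (s, l, e) (s', l', e') =
      ∑ p, dec (B p) (e, l) (e', l') := rfl
  have hr : (Matrix.of fun x y => (traceOut (eMsg (S × (E × B')) P Q) N).submatrix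
      (msgLast S E B' Q) (msgLast S E B' Q) (s, x) (s', y)) = ∑ p, B p := by
    ext x y
    simp [Matrix.sum_apply, traceOut, B, eMsg, msgLast]
  change _ = dec (Matrix.of fun x y => (traceOut (eMsg (S × (E × B')) P Q) N).submatrix
      (msgLast S E B' Q) (msgLast S E B' Q) (s, x) (s', y)) (e, l) (e', l')
  rw [hl, hr, map_sum, Matrix.sum_apply]

/-- A classical message register stays block diagonal. -/
lemma pinch2_traceOut_encoded {S L E P A' B' Q : Type*} [Fintype P] [DecidableEq Q]
    (ent : Matrix (A' × B') (A' × B') ℂ)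
    {enc : Matrix ((P × L) × A') ((P × L) × A') ℂ →ₗ[ℂ] Matrix (P × Q) (P × Q) ℂ}
    (hcl : ∀ M, pinch2 (enc M) = enc M)
    (M : Matrix ((S × (L × E)) × P) ((S × (L × E)) × P) ℂ) :
    pinch2 (traceOut (eMsg (S × (E × B')) P Q) (encoded ent enc M)) =
      traceOut (eMsg (S × (E × B')) P Q) (encoded ent enc M) := by
  ext ⟨r, q⟩ ⟨r', q'⟩
  simp only [pinch2, Matrix.of_apply]
  split_ifs with h
  · rfl
  · symm
    refine Finset.sum_eq_zero fun p _ => ?_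
    change enc _ (p, q) (p, q') = 0
    rw [← hcl]
    simp [pinch2, h]

lemma trace_ptA (ω : Matrix (A' × B') (A' × B') ℂ) : (ptA ω).trace = ω.trace := by
  simp only [Matrix.trace, Matrix.diag_apply, ptA, Matrix.of_apply]
  rw [Finset.sum_comm, Fintype.sum_prod_type]

lemma ptA_posSemidef {A' B' : Type*} [Fintype A'] {ω : Matrix (A' × B') (A' × B') ℂ}
    (hω : ω.PosSemidef) :
    (ptA ω).PosSemidef :=
  traceOut_posSemidef (Equiv.prodComm A' B') hω

/-- Core operator inequality: transmitting the message loses at most a factor `c · |Q|`. -/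
lemma exists_state_marginal_le [DecidableEq S] [DecidableEq Q] [Nonempty Q]
    {ent : Matrix (A' × B') (A' × B') ℂ}
    (hent : IsState ent)
    {enc : Matrix ((P × L) × A') ((P × L) × A') ℂ →ₗ[ℂ] Matrix (P × Q) (P × Q) ℂ}
    (henc : IsCPTP enc)
    {dec : Matrix ((Q × E) × B') ((Q × E) × B') ℂ →ₗ[ℂ] Matrix (E × L) (E × L) ℂ}
    (hdec : IsCPTP dec) {M : Matrix ((S × (L × E)) × P) ((S × (L × E)) × P) ℂ}
    {c : ℝ} (hc : 0 ≤ c)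
    (hcN : traceOut (eMsg (S × (E × B')) P Q) (encoded ent enc M) ≤
      c • (ptB (traceOut (eMsg (S × (E × B')) P Q) (encoded ent enc M)) ⊗ₖ (1 : Matrix Q Q ℂ)))
    {σ : Matrix E E ℂ} (hσ : IsState σ) {μ : ℝ}
    (hM : traceOut (eSE S L E P) M ≤ μ • ((1 : Matrix S S ℂ) ⊗ₖ σ)) :
    ∃ σ' : Matrix (L × E) (L × E) ℂ, IsState σ' ∧
      traceOut (Equiv.refl _) (decoded dec (encoded ent enc M)) ≤
        (c * Fintype.card Q * μ) • ((1 : Matrix S S ℂ) ⊗ₖ σ') := by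
  classical
  set ω : Matrix ((Q × E) × B') ((Q × E) × B') ℂ := ((1 : Matrix Q Q ℂ) ⊗ₖ σ) ⊗ₖ ptA ent with hω
  have hωpos : ω.PosSemidef :=
    (Matrix.PosSemidef.one.kronecker hσ.1).kronecker (ptA_posSemidef hent.1)
  have hωtr : (dec ω).trace = Fintype.card Q := by
    rw [hdec.tp, hω, Matrix.trace_kronecker, Matrix.trace_kronecker, hσ.2, trace_ptA, hent.2,
      Matrix.trace_one, mul_one, mul_one]
  set K := (traceOut (eMsg (S × (E × B')) P Q) (encoded ent enc M)).submatrix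
        (msgLast S E B' Q) (msgLast S E B' Q) with hK
  have hKle : K ≤ (c * μ) • ((1 : Matrix S S ℂ) ⊗ₖ ω) := by
    rw [ptB_traceOut_encoded ent henc] at hcN
    have h1 := real_smul_mono (kronecker_mono_left (submatrix_mono
      (kronecker_mono_left hM (ptA_posSemidef hent.1))
      (fun r : S × (E × B') => ((r.1, r.2.1), r.2.2)))
      (Matrix.PosSemidef.one (n := Q) (R := ℂ))) hc
    have h2 := submatrix_mono (hcN.trans h1)
      (msgLast S E B' Q)
    refine h2.trans_eq ?_
    ext ⟨s, ⟨q, e⟩, b⟩ ⟨s', ⟨q', e'⟩, b'⟩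
    simp [hω, msgLast]
    ring
  have hd : (0 : ℝ) < Fintype.card Q := by exact_mod_cast Fintype.card_pos
  have hdec_le : lext dec K ≤ (c * μ) • ((1 : Matrix S S ℂ) ⊗ₖ dec ω) := by
    have h := lext_mono hdec hKle
    have e : lext dec ((c * μ) • ((1 : Matrix S S ℂ) ⊗ₖ ω)) =
        (c * μ) • ((1 : Matrix S S ℂ) ⊗ₖ dec ω) := by
      rw [← lext_one_kronecker]
      exact LinearMap.map_smul_of_tower (lext dec) (c * μ) _
    rwa [e] at h
  refine ⟨((Fintype.card Q : ℝ)⁻¹) • (dec ω).submatrix Prod.swap Prod.swap, ⟨?_, ?_⟩, ?_⟩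
  · exact ((channel_posSemidef hdec hωpos).submatrix _).smul (inv_nonneg.2 hd.le)
  · rw [Matrix.trace_smul]
    have := trace_reindex (Equiv.prodComm E L) (dec ω)
    rw [hωtr] at this
    have e : ((dec ω).submatrix Prod.swap Prod.swap).trace = Fintype.card Q := this
    rw [e, Complex.real_smul]
    push_cast
    field_simp
  · rw [traceOut_decoded, ← hK]
    refine (submatrix_mono hdec_le _).trans_eq ?_
    ext ⟨s, l, e⟩ ⟨s', l', e'⟩
    simp
    field_simp

end Protocol

section Entropy

open scoped MatrixOrder

lemma neg_logb_le_HminUp {S B : Type*} [Fintype S] [DecidableEq S] [Fintype B] [DecidableEq B]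
    {ρ : Matrix (S × B) (S × B) ℂ} {σ : Matrix B B ℂ} (hσ : IsState σ) {μ : ℝ} (hμ : 0 ≤ μ)
    (h : ρ ≤ μ • ((1 : Matrix S S ℂ) ⊗ₖ σ)) : ((-Real.logb 2 μ : ℝ) : EReal) ≤ HminUp ρ := by
  rw [EReal.coe_neg, HminUp, EReal.neg_le_neg_iff]
  refine sInf_le_of_le (b := Dmax ρ ((1 : Matrix S S ℂ) ⊗ₖ σ)) ⟨σ, hσ, rfl⟩ (sInf_le ?_)
  exact ⟨μ, hμ, Matrix.le_iff.1 h, rfl⟩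

lemma HminUp_le {S B : Type*} [Fintype S] [DecidableEq S] [Fintype B] [DecidableEq B]
    {ρ : Matrix (S × B) (S × B) ℂ} {X : EReal}
    (h : ∀ σ : Matrix B B ℂ, IsState σ → ∀ μ : ℝ, 0 ≤ μ → ρ ≤ μ • ((1 : Matrix S S ℂ) ⊗ₖ σ) →
      ((-Real.logb 2 μ : ℝ) : EReal) ≤ X) : HminUp ρ ≤ X := by
  rw [HminUp, EReal.neg_le]
  refine le_sInf ?_
  rintro _ ⟨σ, hσ, rfl⟩
  refine le_sInf ?_
  rintro _ ⟨μ, hμ, hle, rfl⟩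
  have := h σ hσ μ hμ (Matrix.le_iff.2 hle)
  rwa [EReal.coe_neg, EReal.neg_le] at this

lemma dotProduct_self_eq_one_of_purification {X Y Z : Type*} [Fintype X] [Fintype Y] [Fintype Z]
    {e : X ≃ Y × Z} {ρ : Matrix Y Y ℂ} (hρ : IsState ρ) {ψ : X → ℂ}
    (hψ : traceOut e (pureState ψ) = ρ) : star ψ ⬝ᵥ ψ = 1 := by
  rw [← trace_pureState, ← traceOut_trace e, hψ, hρ.2]

/-- Every substate near a marginal of `ψ` dominates the marginal of a vector near `ψ`. -/
lemma exists_nearby_vector {X Y Z : Type*} [Fintype X] [Fintype Y] [DecidableEq Y] [Fintype Z]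
    (e : X ≃ Y × Z) {ψ : X → ℂ} (hψ : star ψ ⬝ᵥ ψ = 1) {ρ' : Matrix Y Y ℂ} (hρ' : IsSubState ρ')
    {ε : ℝ} (hε0 : 0 ≤ ε) (hε1 : ε < 1) (h : pDist ρ' (traceOut e (pureState ψ)) ≤ ε) :
    ∃ (φ : X → ℂ) (c : ℝ), traceOut e (pureState φ) ≤ ρ' ∧ (star φ ⬝ᵥ φ).re ≤ 1 ∧ φ ≠ 0 ∧
      star ψ ⬝ᵥ φ = (c : ℂ) ∧ 0 ≤ c ∧ 1 - c ^ 2 ≤ ε ^ 2 := by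
  obtain ⟨Φ, hΦ, htr⟩ := exists_uhlmann_partner hρ'.1
    (traceOut_posSemidef e (pureState_posSemidef ψ)) (bipartiteMatrix e ψ)
    (bipartiteMatrix_mul_conjTranspose e ψ)
  obtain ⟨φ, rfl⟩ := exists_bipartiteMatrix_eq e Φ
  rw [bipartiteMatrix_mul_conjTranspose] at hΦ
  rw [bipartiteMatrix_inner] at htr
  have hc := one_sub_sq_le_of_pDist_le hε0 (by rw [traceOut_trace, trace_pureState, hψ]) h
  refine ⟨φ, _, hΦ, ?_, ?_, htr, traceNorm_nonneg _, hc⟩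
  · have h1 := (Complex.le_def.1 (Matrix.le_iff.1 hΦ).trace_nonneg).1
    rw [Matrix.trace_sub, traceOut_trace, trace_pureState, Complex.sub_re, Complex.zero_re] at h1
    linarith [hρ'.2]
  · rintro rfl
    rw [dotProduct_zero] at htr
    rw [Complex.ofReal_eq_zero.1 htr.symm] at hc
    nlinarith

lemma feasible_factor_pos {X S B Z : Type*} [Fintype X] [Fintype S] [DecidableEq S] [Fintype B]
    [Fintype Z] {e : X ≃ (S × B) × Z} {φ : X → ℂ} (hφ : φ ≠ 0) {σ : Matrix B B ℂ} {μ : ℝ}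
    (hμ : 0 ≤ μ) (h : traceOut e (pureState φ) ≤ μ • ((1 : Matrix S S ℂ) ⊗ₖ σ)) : 0 < μ := by
  refine hμ.lt_of_ne ?_
  rintro rfl
  have h1 := (Matrix.le_iff.1 h).trace_nonneg
  rw [zero_smul, zero_sub, Matrix.trace_neg, traceOut_trace, trace_pureState] at h1
  have h2 := (pureState_posSemidef φ).trace_nonneg
  rw [trace_pureState] at h2
  exact hφ (dotProduct_star_self_eq_zero.1 (le_antisymm (neg_nonneg.1 h1) h2))

variable {S L E P A' B' Q : Type*}
  [Fintype S] [DecidableEq S] [Fintype L] [DecidableEq L] [Fintype E] [DecidableEq E]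
  [Fintype P] [DecidableEq P] [Fintype A'] [Fintype B'] [Fintype Q] [DecidableEq Q]

/-- Chain rule when decohering bounds the message by a factor `c`. -/
lemma HminUpEps_sub_le_of_message_bound
    {ρ : Matrix (S × (L × E)) (S × (L × E)) ℂ} (hρ : IsState ρ)
    {ψ : ((S × (L × E)) × P) → ℂ}
    (hψ : traceOut (Equiv.refl ((S × (L × E)) × P)) (pureState ψ) = ρ)
    {ent : Matrix (A' × B') (A' × B') ℂ} (hent : IsState ent)
    {enc : Matrix ((P × L) × A') ((P × L) × A') ℂ →ₗ[ℂ] Matrix (P × Q) (P × Q) ℂ}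
    (henc : IsCPTP enc)
    {dec : Matrix ((Q × E) × B') ((Q × E) × B') ℂ →ₗ[ℂ] Matrix (E × L) (E × L) ℂ}
    (hdec : IsCPTP dec) {δ : ℝ} (hδ : 0 ≤ δ)
    (hprot : pDist (decoded dec (encoded ent enc (pureState ψ))) (pureState ψ) ≤ δ)
    {ε : ℝ} (hε0 : 0 ≤ ε) (hε1 : ε < 1) {c : ℝ} (hc : Nonempty Q → 0 < c)
    (hcN : ∀ M : Matrix ((S × (L × E)) × P) ((S × (L × E)) × P) ℂ, M.PosSemidef →
      traceOut (eMsg (S × (E × B')) P Q) (encoded ent enc M) ≤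
      c • (ptB (traceOut (eMsg (S × (E × B')) P Q) (encoded ent enc M)) ⊗ₖ (1 : Matrix Q Q ℂ))) :
    HminUpEps ε (traceOut (eSEL S L E) ρ) - ((Real.logb 2 (c * Fintype.card Q) : ℝ) : EReal) ≤
      HminUpEps (ε + δ) ρ := by
  have hψ1 := dotProduct_self_eq_one_of_purification hρ hψ
  have hSE : traceOut (eSEL S L E) ρ = traceOut (eSE S L E P) (pureState ψ) := by
    rw [← hψ]
    ext x y
    simp only [traceOut, Matrix.of_apply, Fintype.sum_prod_type]
    rfl
  have hQ : Nonempty Q := by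
    by_contra hemp
    rw [not_nonempty_iff] at hemp
    have h1 := encoded_trace hent henc (pureState ψ)
    rw [trace_pureState, hψ1] at h1
    simp [Matrix.trace] at h1
  have hcpos := hc hQ
  have hd : (0 : ℝ) < Fintype.card Q := by exact_mod_cast Fintype.card_pos
  have hpos : ∀ M : Matrix ((S × (L × E)) × P) ((S × (L × E)) × P) ℂ, M.PosSemidef →
      (decoded dec (encoded ent enc M)).PosSemidef := fun M hM =>
    decoded_posSemidef hdec (encoded_posSemidef hent henc hM)
  have htr : ∀ M : Matrix ((S × (L × E)) × P) ((S × (L × E)) × P) ℂ,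
      (decoded dec (encoded ent enc M)).trace = M.trace := fun M => by
    rw [decoded_trace hdec, encoded_trace hent henc]
  have hh : 1 - (decoded dec (encoded ent enc (pureState ψ)) * pureState ψ).trace.re ≤ δ ^ 2 := by
    have h1 := one_sub_sq_le_of_pDist_le hδ (by rw [trace_pureState, hψ1]) hprot
    have h2 := traceNorm_sq_le_overlap (hpos _ (pureState_posSemidef ψ)) ψ
    linarith
  rw [hSE]
  refine EReal.sub_le_of_le_add (sSup_le ?_)
  rintro _ ⟨ρ', hρ', hdist, rfl⟩
  obtain ⟨φ, F, hφρ', hφ1, hφ0, hF, hF0, hFε⟩ := exists_nearby_vector _ hψ1 hρ' hε0 hε1 hdist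
  have hov := one_sub_overlap_le (decoded dec ∘ₗ encoded ent enc) hpos htr hψ1 hφ1 hF hF0 hFε
    hε0 hδ hh
  set τ := decoded dec (encoded ent enc (pureState φ)) with hτ
  have hτpos : τ.PosSemidef := hpos _ (pureState_posSemidef φ)
  have hsub : IsSubState (traceOut (Equiv.refl ((S × (L × E)) × P)) τ) :=
    ⟨traceOut_posSemidef _ hτpos, by rwa [traceOut_trace, htr, trace_pureState]⟩
  have hnear : pDist (traceOut (Equiv.refl ((S × (L × E)) × P)) τ) ρ ≤ ε + δ := by
    rw [pDist, gFid_eq_traceNorm _ hρ.2, Real.sqrt_le_left (add_nonneg hε0 hδ)]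
    have h1 := overlap_le_traceNorm_sq (Equiv.refl ((S × (L × E)) × P)) hτpos ψ
    rw [hψ] at h1
    exact (sub_le_sub_left h1 1).trans hov
  refine HminUp_le fun σ hσ μ hμ hle => ?_
  have hμ0 := feasible_factor_pos hφ0 hμ (hφρ'.trans hle)
  obtain ⟨σ', hσ', hle'⟩ := exists_state_marginal_le hent henc hdec hcpos.le
    (hcN _ (pureState_posSemidef φ)) hσ (hφρ'.trans hle)
  have hlow := (neg_logb_le_HminUp hσ' (by positivity) hle').trans
    (le_sSup ⟨_, hsub, hnear, rfl⟩ : _ ≤ HminUpEps (ε + δ) ρ)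
  have hlog : -Real.logb 2 μ = -Real.logb 2 (c * Fintype.card Q * μ) +
      Real.logb 2 (c * Fintype.card Q) := by
    rw [Real.logb_mul (mul_pos hcpos hd).ne' hμ0.ne']
    ring
  rw [hlog, EReal.coe_add]
  exact add_le_add_left hlow _

/-- Any message can be decohered at the price of a factor `|Q|`. -/
lemma traceOut_encoded_le {S L E P A' B' Q : Type*} [Fintype S] [Fintype L] [Fintype E]
    [Fintype P] [Fintype A'] [Fintype B'] [Fintype Q] [DecidableEq Q]
    {ent : Matrix (A' × B') (A' × B') ℂ} (hent : IsState ent)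
    {enc : Matrix ((P × L) × A') ((P × L) × A') ℂ →ₗ[ℂ] Matrix (P × Q) (P × Q) ℂ}
    (henc : IsCPTP enc) (M : Matrix ((S × (L × E)) × P) ((S × (L × E)) × P) ℂ)
    (hM : M.PosSemidef) :
    traceOut (eMsg (S × (E × B')) P Q) (encoded ent enc M) ≤
      (Fintype.card Q : ℝ) • (ptB (traceOut (eMsg (S × (E × B')) P Q) (encoded ent enc M)) ⊗ₖ
        (1 : Matrix Q Q ℂ)) := by
  have h := traceOut_posSemidef (eMsg (S × (E × B')) P Q) (encoded_posSemidef hent henc hM)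
  exact (le_card_smul_pinch2 h).trans
    (real_smul_mono (pinch2_le_kronecker h) (Nat.cast_nonneg _))

/-- A classical message needs no decohering. -/
lemma traceOut_encoded_le_of_classical {S L E P A' B' Q : Type*} [Fintype S] [Fintype L]
    [Fintype E] [Fintype P] [Fintype A'] [Fintype B'] [Fintype Q] [DecidableEq Q]
    {ent : Matrix (A' × B') (A' × B') ℂ} (hent : IsState ent)
    {enc : Matrix ((P × L) × A') ((P × L) × A') ℂ →ₗ[ℂ] Matrix (P × Q) (P × Q) ℂ}
    (henc : IsCPTP enc) (hcl : ∀ M, pinch2 (enc M) = enc M)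
    (M : Matrix ((S × (L × E)) × P) ((S × (L × E)) × P) ℂ) (hM : M.PosSemidef) :
    traceOut (eMsg (S × (E × B')) P Q) (encoded ent enc M) ≤
      (1 : ℝ) • (ptB (traceOut (eMsg (S × (E × B')) P Q) (encoded ent enc M)) ⊗ₖ
        (1 : Matrix Q Q ℂ)) := by
  have h := pinch2_le_kronecker
    (traceOut_posSemidef (eMsg (S × (E × B')) P Q) (encoded_posSemidef hent henc hM))
  rwa [pinch2_traceOut_encoded ent hcl, ← one_smul ℝ (ptB _ ⊗ₖ _)] at h

end Entropy

theorem hmin_chain_rule_from_state_redistribution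
    {S L E P A' B' Q : Type*}
    [Fintype S] [DecidableEq S] [Fintype L] [DecidableEq L] [Fintype E] [DecidableEq E]
    [Fintype P] [DecidableEq P] [Fintype A'] [DecidableEq A'] [Fintype B'] [DecidableEq B']
    [Fintype Q] [DecidableEq Q]
    (ρ : Matrix (S × (L × E)) (S × (L × E)) ℂ) (hρ : IsState ρ)
    -- `ψ` purifies `ρ`
    (ψ : ((S × (L × E)) × P) → ℂ)
    (hψ : traceOut (Equiv.refl ((S × (L × E)) × P)) (pureState ψ) = ρ)
    -- shared entanglement between Alice and Bob
    (ent : Matrix (A' × B') (A' × B') ℂ) (hent : IsState ent)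
    -- encoder and decoder of the δ-state-redistribution protocol
    (enc : Matrix ((P × L) × A') ((P × L) × A') ℂ →ₗ[ℂ] Matrix (P × Q) (P × Q) ℂ)
    (henc : IsCPTP enc)
    (dec : Matrix ((Q × E) × B') ((Q × E) × B') ℂ →ₗ[ℂ] Matrix (E × L) (E × L) ℂ)
    (hdec : IsCPTP dec)
    (δ : ℝ) (hδ : 0 ≤ δ)
    -- the protocol reproduces the state up to purified distance δ
    (hprot : pDist
      ((Matrix.reindex (eFin S L E P) (eFin S L E P))
        ((lext dec)
          ((Matrix.reindex (eDec S E P B' Q) (eDec S E P B' Q))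
            ((lext enc)
              ((Matrix.reindex (eEnc S L E P A' B') (eEnc S L E P A' B'))
                ((pureState ψ) ⊗ₖ ent))))))
      (pureState ψ) ≤ δ)
    (ε : ℝ) (hε0 : 0 ≤ ε) (hε1 : ε < 1) :
    (HminUpEps (ε + δ) ρ ≥
      HminUpEps ε (traceOut (eSEL S L E) ρ)
        - ((2 * Real.logb 2 (Fintype.card Q) : ℝ) : EReal))
    ∧
    -- if the message register `Q` is classical
    ((∀ M : Matrix ((P × L) × A') ((P × L) × A') ℂ, pinch2 (enc M) = enc M) →
      HminUpEps (ε + δ) ρ ≥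
        HminUpEps ε (traceOut (eSEL S L E) ρ)
          - ((Real.logb 2 (Fintype.card Q) : ℝ) : EReal)) := by
  refine ⟨?_, fun hcl => ?_⟩
  · have h := HminUpEps_sub_le_of_message_bound hρ hψ hent henc hdec hδ hprot hε0 hε1
      (c := Fintype.card Q) (fun _ => by exact_mod_cast Fintype.card_pos)
      (traceOut_encoded_le hent henc)
    rwa [← sq, Real.logb_pow, Nat.cast_ofNat] at h
  · have h := HminUpEps_sub_le_of_message_bound hρ hψ hent henc hdec hδ hprot hε0 hε1
      (c := 1) (fun _ => one_pos) (traceOut_encoded_le_of_classical hent henc hcl)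
    rwa [one_mul] at h

end QITLeak
end
end

section
/- Let ρ be a normalized state on registers A, B, C, let σ_C be positive semidefinite on C, and let ω'_A, ω''_B be normalized states on A and B respectively; assume α ∈ (0,1)∪(1,∞) and that supp(ρ_ABC) ⊆ supp(ω'_A⊗ω''_B⊗σ_C) (so that all divergences below are finite). Define ν_AC = (ρ_AC^{1/2}(ω'_A⊗σ_C)^{(1−α)/α}ρ_AC^{1/2})^α / Tr[(ρ_AC^{1/2}(ω'_A⊗σ_C)^{(1−α)/α}ρ_AC^{1/2})^α] and ν_ABC = ν_AC^{1/2}·ρ_{B|AC}·ν_AC^{1/2}. Then the exact identity D_α(ρ_ABC‖ω'_A⊗ω''_B⊗σ_C) = D_α(ρ_AC‖ω'_A⊗σ_C) + D_α(ν_ABC‖ω''_B⊗ν_AC) holds. -/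
open scoped Kronecker
open Matrix
open scoped ComplexOrder

noncomputable section
namespace QITLeak

variable {A B : Type*}

theorem ptB_trace [Fintype A] [Fintype B] (ρ : Matrix (A × B) (A × B) ℂ) :
    (ptB ρ).trace = ρ.trace := by
  simp [ptB, Matrix.trace, Fintype.sum_prod_type]

theorem ptB_conj [Fintype A] [Fintype B] [DecidableEq B] (X Y : Matrix A A ℂ)
    (ρ : Matrix (A × B) (A × B) ℂ) :
    ptB ((X ⊗ₖ (1 : Matrix B B ℂ)) * ρ * (Y ⊗ₖ (1 : Matrix B B ℂ))) = X * ptB ρ * Y := by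
  ext a a'
  simp only [ptB, Matrix.of_apply, Matrix.mul_apply, Fintype.sum_prod_type,
    Matrix.kroneckerMap_apply, Matrix.one_apply, mul_ite, mul_one, mul_zero, ite_mul, zero_mul,
    Finset.sum_ite_eq, Finset.sum_ite_eq', Finset.mem_univ, if_true, Finset.sum_mul,
    Finset.mul_sum]
  rw [Finset.sum_comm]
  refine Finset.sum_congr rfl fun x _ => ?_
  rw [Finset.sum_comm]

theorem ptB_posSemidef [Fintype B] {ρ : Matrix (A × B) (A × B) ℂ} (hρ : ρ.PosSemidef) :
    (ptB ρ).PosSemidef := by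
  have h : ptB ρ = ∑ b : B, ρ.submatrix (fun a => (a, b)) (fun a => (a, b)) := by
    ext a a'
    simp [ptB, Matrix.sum_apply]
  rw [h]
  exact Matrix.posSemidef_sum _ fun b _ => hρ.submatrix _

section Spectral
variable [Fintype A] [DecidableEq A] [Fintype B] [DecidableEq B]

/-- The matrix `U diag(d) U†` with real diagonal `d`. -/
def conjDiag (U : Matrix A A ℂ) (d : A → ℝ) : Matrix A A ℂ :=
  U * Matrix.diagonal (fun i => (d i : ℂ)) * star U

theorem conjDiag_mul {U : Matrix A A ℂ} (hU : U ∈ unitary (Matrix A A ℂ)) (d e : A → ℝ) :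
    conjDiag U d * conjDiag U e = conjDiag U (fun i => d i * e i) := by
  have h : star U * U = 1 := (Unitary.mem_iff.1 hU).1
  calc conjDiag U d * conjDiag U e
      = U * Matrix.diagonal (fun i => (d i : ℂ)) * (star U * U) *
          Matrix.diagonal (fun i => (e i : ℂ)) * star U := by
        simp only [conjDiag, Matrix.mul_assoc]
    _ = _ := by
        rw [h, Matrix.mul_one, Matrix.mul_assoc U, Matrix.diagonal_mul_diagonal]
        simp [conjDiag]

theorem conjDiag_kronecker (U : Matrix A A ℂ) (V : Matrix B B ℂ) (d : A → ℝ) (e : B → ℝ) :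
    conjDiag U d ⊗ₖ conjDiag V e = conjDiag (U ⊗ₖ V) (fun i => d i.1 * e i.2) := by
  simp only [conjDiag, Matrix.mul_kronecker_mul, Matrix.star_eq_conjTranspose,
    Matrix.conjTranspose_kronecker, Matrix.diagonal_kronecker_diagonal, Complex.ofReal_mul]

theorem smul_conjDiag (U : Matrix A A ℂ) (d : A → ℝ) (t : ℝ) :
    (t : ℂ) • conjDiag U d = conjDiag U (fun i => t * d i) := by
  have h : Matrix.diagonal (fun i => ((t * d i : ℝ) : ℂ))
      = (t : ℂ) • Matrix.diagonal (fun i => (d i : ℂ)) := by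
    rw [← Matrix.diagonal_smul]
    congr 1
    ext i
    simp
  rw [conjDiag, conjDiag, h, Matrix.mul_smul, Matrix.smul_mul]

theorem conjDiag_posSemidef (U : Matrix A A ℂ) {d : A → ℝ} (hd : ∀ i, 0 ≤ d i) :
    (conjDiag U d).PosSemidef := by
  rw [conjDiag, Matrix.star_eq_conjTranspose]
  refine Matrix.PosSemidef.mul_mul_conjTranspose_same ?_ U
  exact Matrix.PosSemidef.diagonal fun i => by simpa using hd i

/-- Functional calculus does not depend on the chosen diagonalization. -/
theorem conjDiag_comp_eq {U V : Matrix A A ℂ} (hU : U ∈ unitary (Matrix A A ℂ))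
    (hV : V ∈ unitary (Matrix A A ℂ)) {d e : A → ℝ} (h : conjDiag U d = conjDiag V e)
    (f : ℝ → ℝ) : conjDiag U (fun i => f (d i)) = conjDiag V (fun i => f (e i)) := by
  have hU1 : star U * U = 1 := (Unitary.mem_iff.1 hU).1
  have hU2 : U * star U = 1 := (Unitary.mem_iff.1 hU).2
  have hV1 : star V * V = 1 := (Unitary.mem_iff.1 hV).1
  have hV2 : V * star V = 1 := (Unitary.mem_iff.1 hV).2
  have key : (star V * U) * Matrix.diagonal (fun i => (d i : ℂ))
      = Matrix.diagonal (fun i => (e i : ℂ)) * (star V * U) := by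
    have := congrArg (fun M => star V * M * U) h
    simp only [conjDiag] at this
    calc _ = star V * (U * Matrix.diagonal (fun i => (d i : ℂ)) * star U) * U := by
          simp only [Matrix.mul_assoc, hU1, Matrix.mul_one]
      _ = _ := this
      _ = (star V * V) * (Matrix.diagonal (fun i => (e i : ℂ)) * (star V * U)) := by
          simp only [Matrix.mul_assoc]
      _ = _ := by rw [hV1, Matrix.one_mul]
  have key' : (star V * U) * Matrix.diagonal (fun i => (f (d i) : ℂ))
      = Matrix.diagonal (fun i => (f (e i) : ℂ)) * (star V * U) := by
    ext i j
    have hij := congrFun (congrFun key i) j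
    rw [Matrix.mul_diagonal, Matrix.diagonal_mul] at hij ⊢
    by_cases hz : (star V * U) i j = 0
    · simp [hz]
    · have hde : (d j : ℂ) = (e i : ℂ) :=
        mul_left_cancel₀ hz (by rw [hij, mul_comm])
      rw [Complex.ofReal_injective hde, mul_comm]
  calc conjDiag U (fun i => f (d i))
      = (V * star V) * (U * Matrix.diagonal (fun i => (f (d i) : ℂ)) * star U) := by
        rw [hV2, Matrix.one_mul]; rfl
    _ = V * ((star V * U) * Matrix.diagonal (fun i => (f (d i) : ℂ))) * star U := by
        simp only [Matrix.mul_assoc]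
    _ = V * Matrix.diagonal (fun i => (f (e i) : ℂ)) * star V * (U * star U) := by
        rw [key']; simp only [Matrix.mul_assoc]
    _ = _ := by rw [hU2, Matrix.mul_one]; rfl

theorem eq_conjDiag_eigenvalues {ρ : Matrix A A ℂ} (hρ : ρ.IsHermitian) :
    ρ = conjDiag (hρ.eigenvectorUnitary : Matrix A A ℂ) hρ.eigenvalues := by
  conv_lhs => rw [hρ.spectral_theorem, Unitary.conjStarAlgAut_apply]
  rfl

theorem mpow_conjDiag {U : Matrix A A ℂ} (hU : U ∈ unitary (Matrix A A ℂ)) {d : A → ℝ}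
    (hd : ∀ i, 0 ≤ d i) (p : ℝ) : mpow (conjDiag U d) p = conjDiag U (fun i => d i ^ p) := by
  have hρ := (conjDiag_posSemidef U hd).isHermitian
  rw [mpow, dif_pos hρ]
  exact conjDiag_comp_eq hρ.eigenvectorUnitary.2 hU (eq_conjDiag_eigenvalues hρ).symm
    (fun x => x ^ p)

theorem exists_eq_conjDiag {ρ : Matrix A A ℂ} (hρ : ρ.PosSemidef) :
    ∃ (U : Matrix A A ℂ) (d : A → ℝ), U ∈ unitary (Matrix A A ℂ) ∧ (∀ i, 0 ≤ d i) ∧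
      ρ = conjDiag U d :=
  ⟨_, _, hρ.isHermitian.eigenvectorUnitary.2, hρ.eigenvalues_nonneg,
    eq_conjDiag_eigenvalues hρ.isHermitian⟩

theorem mpow_posSemidef {ρ : Matrix A A ℂ} (hρ : ρ.PosSemidef) (p : ℝ) :
    (mpow ρ p).PosSemidef := by
  obtain ⟨U, d, hU, hd, rfl⟩ := exists_eq_conjDiag hρ
  rw [mpow_conjDiag hU hd]
  exact conjDiag_posSemidef U fun i => Real.rpow_nonneg (hd i) p

theorem conjTranspose_mpow {ρ : Matrix A A ℂ} (hρ : ρ.PosSemidef) (p : ℝ) :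
    (mpow ρ p)ᴴ = mpow ρ p :=
  (mpow_posSemidef hρ p).isHermitian

theorem mpow_one {ρ : Matrix A A ℂ} (hρ : ρ.PosSemidef) : mpow ρ 1 = ρ := by
  obtain ⟨U, d, hU, hd, rfl⟩ := exists_eq_conjDiag hρ
  simp [mpow_conjDiag hU hd]

theorem mpow_mul_mpow {ρ : Matrix A A ℂ} (hρ : ρ.PosSemidef) {p q r : ℝ} (hpq : p + q = r)
    (hr : r ≠ 0) : mpow ρ p * mpow ρ q = mpow ρ r := by
  obtain ⟨U, d, hU, hd, rfl⟩ := exists_eq_conjDiag hρ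
  simp only [mpow_conjDiag hU hd, conjDiag_mul hU]
  congr 1
  ext i
  rw [← hpq, Real.rpow_add' (hd i) (hpq ▸ hr)]

theorem mpow_mpow {ρ : Matrix A A ℂ} (hρ : ρ.PosSemidef) (p q : ℝ) :
    mpow (mpow ρ p) q = mpow ρ (p * q) := by
  obtain ⟨U, d, hU, hd, rfl⟩ := exists_eq_conjDiag hρ
  rw [mpow_conjDiag hU hd, mpow_conjDiag hU fun i => Real.rpow_nonneg (hd i) p,
    mpow_conjDiag hU hd]
  congr 1
  ext i
  rw [Real.rpow_mul (hd i)]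

theorem mpow_smul {ρ : Matrix A A ℂ} (hρ : ρ.PosSemidef) {t : ℝ} (ht : 0 ≤ t) (p : ℝ) :
    mpow ((t : ℂ) • ρ) p = ((t ^ p : ℝ) : ℂ) • mpow ρ p := by
  obtain ⟨U, d, hU, hd, rfl⟩ := exists_eq_conjDiag hρ
  rw [smul_conjDiag, mpow_conjDiag hU fun i => mul_nonneg ht (hd i), mpow_conjDiag hU hd,
    smul_conjDiag]
  congr 1
  ext i
  rw [Real.mul_rpow ht (hd i)]

theorem mpow_kronecker {ρ : Matrix A A ℂ} {σ : Matrix B B ℂ} (hρ : ρ.PosSemidef)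
    (hσ : σ.PosSemidef) (p : ℝ) : mpow (ρ ⊗ₖ σ) p = mpow ρ p ⊗ₖ mpow σ p := by
  obtain ⟨U, d, hU, hd, rfl⟩ := exists_eq_conjDiag hρ
  obtain ⟨V, e, hV, he, rfl⟩ := exists_eq_conjDiag hσ
  rw [conjDiag_kronecker, mpow_conjDiag (Matrix.kronecker_mem_unitary hU hV)
    fun i => mul_nonneg (hd i.1) (he i.2), mpow_conjDiag hU hd, mpow_conjDiag hV he,
    conjDiag_kronecker]
  congr 1
  ext i
  rw [Real.mul_rpow (hd i.1) (he i.2)]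

/-- The orthogonal projection onto the support of a positive semidefinite matrix. -/
def suppProj (ρ : Matrix A A ℂ) : Matrix A A ℂ := mpow ρ (-1) * mpow ρ 1

theorem suppProj_kronecker {ρ : Matrix A A ℂ} {σ : Matrix B B ℂ} (hρ : ρ.PosSemidef)
    (hσ : σ.PosSemidef) : suppProj (ρ ⊗ₖ σ) = suppProj ρ ⊗ₖ suppProj σ := by
  simp only [suppProj, mpow_kronecker hρ hσ, Matrix.mul_kronecker_mul]

theorem mpow_neg_mul_mpow {ρ : Matrix A A ℂ} (hρ : ρ.PosSemidef) {p q : ℝ} (hp : p ≠ 0)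
    (hpq : p + q = 0) : mpow ρ p * mpow ρ q = suppProj ρ := by
  obtain rfl : q = -p := by linarith
  obtain ⟨U, d, hU, hd, rfl⟩ := exists_eq_conjDiag hρ
  simp only [suppProj, mpow_conjDiag hU hd, conjDiag_mul hU]
  congr 1
  ext i
  rcases (hd i).eq_or_lt with h | h
  · simp [← h, Real.zero_rpow hp]
  · rw [← Real.rpow_add h, ← Real.rpow_add h]; simp

theorem suppProj_mul_mpow {ρ : Matrix A A ℂ} (hρ : ρ.PosSemidef) {p : ℝ} (hp : p ≠ 0) :
    suppProj ρ * mpow ρ p = mpow ρ p := by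
  rw [← mpow_neg_mul_mpow hρ (p := p) (q := -p) hp (by ring), Matrix.mul_assoc]
  obtain ⟨U, d, hU, hd, rfl⟩ := exists_eq_conjDiag hρ
  simp only [mpow_conjDiag hU hd, conjDiag_mul hU]
  congr 1
  ext i
  rcases (hd i).eq_or_lt with h | h
  · simp [← h, Real.zero_rpow hp]
  · rw [← Real.rpow_add h, ← Real.rpow_add h]; simp

theorem mpow_mul_suppProj {ρ : Matrix A A ℂ} (hρ : ρ.PosSemidef) {p : ℝ} (hp : p ≠ 0) :
    mpow ρ p * suppProj ρ = mpow ρ p := by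
  rw [← mpow_neg_mul_mpow hρ (p := p) (q := -p) hp (by ring)]
  obtain ⟨U, d, hU, hd, rfl⟩ := exists_eq_conjDiag hρ
  simp only [mpow_conjDiag hU hd, conjDiag_mul hU]
  congr 1
  ext i
  rcases (hd i).eq_or_lt with h | h
  · simp [← h, Real.zero_rpow hp]
  · rw [← Real.rpow_add h, ← Real.rpow_add h]; simp

theorem mul_suppProj_self {ρ : Matrix A A ℂ} (hρ : ρ.PosSemidef) : ρ * suppProj ρ = ρ := by
  simpa [mpow_one hρ] using mpow_mul_suppProj hρ one_ne_zero

theorem conjTranspose_suppProj {ρ : Matrix A A ℂ} (hρ : ρ.PosSemidef) :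
    (suppProj ρ)ᴴ = suppProj ρ := by
  conv_lhs => rw [suppProj]
  rw [Matrix.conjTranspose_mul, conjTranspose_mpow hρ, conjTranspose_mpow hρ,
    mpow_neg_mul_mpow hρ one_ne_zero (by norm_num)]

theorem suppProj_mul_suppProj {ρ : Matrix A A ℂ} (hρ : ρ.PosSemidef) :
    suppProj ρ * suppProj ρ = suppProj ρ := by
  conv_lhs => rhs; rw [suppProj]
  rw [← Matrix.mul_assoc, suppProj_mul_mpow hρ (by norm_num)]
  rfl

theorem mul_suppProj_of_suppSubset {ρ σ : Matrix A A ℂ} (hσ : σ.PosSemidef)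
    (h : suppSubset ρ σ) : ρ * suppProj σ = ρ := by
  have h1 : σ * (1 - suppProj σ) = 0 := by
    rw [Matrix.mul_sub, mul_suppProj_self hσ, Matrix.mul_one, sub_self]
  have h2 : ρ * (1 - suppProj σ) = 0 := by
    ext i j
    have := h ((1 - suppProj σ).col j) (by
      ext k
      simpa [Matrix.mul_apply, Matrix.mulVec, dotProduct] using congrFun (congrFun h1 k) j)
    simpa [Matrix.mul_apply, Matrix.mulVec, dotProduct] using congrFun this i
  rw [Matrix.mul_sub, Matrix.mul_one, sub_eq_zero] at h2
  exact h2.symm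

theorem suppSubset_of_mul_suppProj {ρ σ : Matrix A A ℂ} (hσ : σ.PosSemidef)
    (h : ρ * suppProj σ = ρ) : suppSubset ρ σ := by
  intro v hv
  rw [← h, suppProj, mpow_one hσ, ← Matrix.mulVec_mulVec, ← Matrix.mulVec_mulVec, hv]
  simp

theorem trace_mpow {ρ : Matrix A A ℂ} (hρ : ρ.IsHermitian) (p : ℝ) :
    (mpow ρ p).trace = (ρ.charpoly.roots.map fun z => ((z.re ^ p : ℝ) : ℂ)).sum := by
  rw [mpow, dif_pos hρ, Matrix.trace_mul_comm, ← Matrix.mul_assoc,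
    (Unitary.mem_iff.1 hρ.eigenvectorUnitary.2).1, Matrix.one_mul, Matrix.trace_diagonal,
    hρ.roots_charpoly_eq_eigenvalues, Multiset.map_map]
  rfl

theorem trace_mpow_mul_conjTranspose_comm (Z : Matrix A A ℂ) (p : ℝ) :
    (mpow (Z * Zᴴ) p).trace = (mpow (Zᴴ * Z) p).trace := by
  rw [trace_mpow (Matrix.posSemidef_self_mul_conjTranspose Z).isHermitian,
    trace_mpow (Matrix.posSemidef_conjTranspose_mul_self Z).isHermitian,
    Matrix.charpoly_mul_comm]

theorem trace_mpow_pos {ρ : Matrix A A ℂ} (hρ : ρ.PosSemidef) (h0 : ρ ≠ 0) {p : ℝ}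
    (hp : p ≠ 0) : 0 < (mpow ρ p).trace := by
  have hP := mpow_posSemidef hρ p
  refine lt_of_le_of_ne hP.trace_nonneg fun h => h0 ?_
  have hz := hP.trace_eq_zero_iff.1 h.symm
  rw [← mpow_one hρ, ← suppProj_mul_mpow hρ one_ne_zero,
    ← mpow_neg_mul_mpow hρ hp (add_neg_cancel p), hz]
  simp

theorem mul_eq_zero_of_conj_eq_zero {ρ : Matrix A A ℂ} (hρ : ρ.PosSemidef) {Q : Matrix A A ℂ}
    (h : (Qᴴ * ρ * Q).trace = 0) : ρ * Q = 0 := by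
  have hh : mpow ρ (1 / 2) * mpow ρ (1 / 2) = ρ := by
    rw [mpow_mul_mpow hρ (r := 1) (by norm_num) one_ne_zero, mpow_one hρ]
  have h1 : ((mpow ρ (1 / 2) * Q)ᴴ * (mpow ρ (1 / 2) * Q)).trace = 0 := by
    rw [Matrix.conjTranspose_mul, conjTranspose_mpow hρ, Matrix.mul_assoc,
      ← Matrix.mul_assoc (mpow ρ (1 / 2)), hh, ← Matrix.mul_assoc, h]
  rw [Matrix.trace_conjTranspose_mul_self_eq_zero_iff] at h1
  rw [← hh, Matrix.mul_assoc, h1, Matrix.mul_zero]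

/-- The support of a bipartite state lies in the support of its marginal. -/
theorem mul_suppProj_ptB {ρ : Matrix (A × B) (A × B) ℂ} (hρ : ρ.PosSemidef) :
    ρ * (suppProj (ptB ρ) ⊗ₖ (1 : Matrix B B ℂ)) = ρ := by
  have hR := ptB_posSemidef hρ
  have h : ρ * ((1 - suppProj (ptB ρ)) ⊗ₖ (1 : Matrix B B ℂ)) = 0 := by
    apply mul_eq_zero_of_conj_eq_zero hρ
    rw [Matrix.conjTranspose_kronecker, Matrix.conjTranspose_one, ← ptB_trace, ptB_conj,
      Matrix.mul_assoc, Matrix.mul_sub, mul_suppProj_self hR]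
    simp
  have hs : (1 - suppProj (ptB ρ)) ⊗ₖ (1 : Matrix B B ℂ)
      = 1 - suppProj (ptB ρ) ⊗ₖ (1 : Matrix B B ℂ) := by
    have h1 : (1 - suppProj (ptB ρ)) ⊗ₖ (1 : Matrix B B ℂ)
        = (1 : Matrix A A ℂ) ⊗ₖ (1 : Matrix B B ℂ) - suppProj (ptB ρ) ⊗ₖ (1 : Matrix B B ℂ) := by
      ext i j
      simp only [Matrix.kroneckerMap_apply, Matrix.sub_apply, sub_mul]
    rw [h1, Matrix.one_kronecker_one]
  rw [hs, Matrix.mul_sub, Matrix.mul_one, sub_eq_zero] at h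
  exact h.symm

theorem suppProj_mul_of_mul_suppProj {ρ σ : Matrix A A ℂ} (hρ : ρ.PosSemidef)
    (hσ : σ.PosSemidef) (h : ρ * suppProj σ = ρ) : suppProj σ * ρ = ρ := by
  have := congrArg Matrix.conjTranspose h
  rwa [Matrix.conjTranspose_mul, conjTranspose_suppProj hσ, hρ.isHermitian.eq] at this

/-- The sandwiched quantity is positive when the first argument is nonzero and supported in the
second. -/
theorem trace_mpow_sandwich_pos {ρ σ : Matrix A A ℂ} (hρ : ρ.PosSemidef) (h0 : ρ ≠ 0)
    (hσ : σ.PosSemidef) (h : ρ * suppProj σ = ρ) {s p : ℝ} (hs : s ≠ 0) (hp : p ≠ 0) :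
    0 < (mpow (mpow σ s * ρ * mpow σ s) p).trace := by
  refine trace_mpow_pos ?_ (fun hz => h0 ?_) hp
  · simpa [conjTranspose_mpow hσ] using hρ.mul_mul_conjTranspose_same (mpow σ s)
  · have h' := suppProj_mul_of_mul_suppProj hρ hσ h
    calc ρ = suppProj σ * ρ * suppProj σ := by rw [h', h]
      _ = mpow σ (-s) * (mpow σ s * ρ * mpow σ s) * mpow σ (-s) := by
          rw [← Matrix.mul_assoc, ← Matrix.mul_assoc,
            mpow_neg_mul_mpow hσ (neg_ne_zero.2 hs) (neg_add_cancel s),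
            Matrix.mul_assoc _ (mpow σ s), mpow_neg_mul_mpow hσ hs (add_neg_cancel s)]
      _ = 0 := by simp [hz]

theorem D_of_suppSubset (α : ℝ) {ρ σ : Matrix A A ℂ} (h : suppSubset ρ σ) :
    D α ρ σ = ((DR α ρ σ : ℝ) : EReal) :=
  if_pos (Or.inr h)

/-- Sandwiching by `K ⊗ w` affects the spectrum only through `K† K`. -/
theorem trace_mpow_conj_congr {T : Matrix (A × B) (A × B) ℂ} (hT : T.PosSemidef)
    {K L : Matrix A A ℂ} (hKL : Kᴴ * K = Lᴴ * L) (w : Matrix B B ℂ) (p : ℝ) :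
    (mpow ((K ⊗ₖ w) * T * (K ⊗ₖ w)ᴴ) p).trace = (mpow ((L ⊗ₖ w) * T * (L ⊗ₖ w)ᴴ) p).trace := by
  have hh : mpow T (1 / 2) * mpow T (1 / 2) = T := by
    rw [mpow_mul_mpow hT (r := 1) (by norm_num) one_ne_zero, mpow_one hT]
  have key (N : Matrix A A ℂ) : (mpow ((N ⊗ₖ w) * T * (N ⊗ₖ w)ᴴ) p).trace
      = (mpow (mpow T (1 / 2) * ((Nᴴ * N) ⊗ₖ (wᴴ * w)) * mpow T (1 / 2)) p).trace := by
    have := trace_mpow_mul_conjTranspose_comm ((N ⊗ₖ w) * mpow T (1 / 2)) p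
    rw [Matrix.conjTranspose_mul, conjTranspose_mpow hT] at this
    convert this using 3
    · conv_lhs => rw [← hh]
      simp only [Matrix.mul_assoc]
    · rw [Matrix.mul_kronecker_mul, Matrix.conjTranspose_kronecker]
      simp only [Matrix.mul_assoc]
  rw [key, key, hKL]

end Spectral

/-! ## Statement 4
Exact identity `D_α(ρ_ABC‖ω'_A⊗ω''_B⊗σ_C) = D_α(ρ_AC‖ω'_A⊗σ_C) + D_α(ν_ABC‖ω''_B⊗ν_AC)`.
The tripartite state is arranged on `(A × C) × B`. -/

theorem renyi_divergence_exact_chain_tripartite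
    {A B C : Type*} [Fintype A] [DecidableEq A] [Fintype B] [DecidableEq B]
    [Fintype C] [DecidableEq C]
    (ρ : Matrix ((A × C) × B) ((A × C) × B) ℂ) (hρ : IsState ρ)
    (σ : Matrix C C ℂ) (hσ : σ.PosSemidef)
    (ω' : Matrix A A ℂ) (hω' : IsState ω')
    (ω'' : Matrix B B ℂ) (hω'' : IsState ω'')
    (α : ℝ) (hα : α ∈ Set.Ioo (0 : ℝ) 1 ∪ Set.Ioi (1 : ℝ))
    (hsupp : suppSubset ρ ((ω' ⊗ₖ σ) ⊗ₖ ω''))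
    -- `ν_AC = (ρ_AC^{1/2} (ω'_A⊗σ_C)^{(1−α)/α} ρ_AC^{1/2})^α / Tr[…]`
    (νAC : Matrix (A × C) (A × C) ℂ)
    (hνAC : νAC =
      ((mpow (mpow (ptB ρ) (1 / 2 : ℝ) * mpow (ω' ⊗ₖ σ) ((1 - α) / α) *
          mpow (ptB ρ) (1 / 2 : ℝ)) α).trace)⁻¹
        • mpow (mpow (ptB ρ) (1 / 2 : ℝ) * mpow (ω' ⊗ₖ σ) ((1 - α) / α) *
            mpow (ptB ρ) (1 / 2 : ℝ)) α)
    -- `ν_ABC = ν_AC^{1/2} ρ_{B|AC} ν_AC^{1/2}`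
    (νABC : Matrix ((A × C) × B) ((A × C) × B) ℂ)
    (hνABC : νABC = ((mpow νAC (1 / 2 : ℝ)) ⊗ₖ (1 : Matrix B B ℂ)) *
      (((mpow (ptB ρ) (-(1 / 2) : ℝ)) ⊗ₖ (1 : Matrix B B ℂ)) * ρ *
        ((mpow (ptB ρ) (-(1 / 2) : ℝ)) ⊗ₖ (1 : Matrix B B ℂ))) *
      ((mpow νAC (1 / 2 : ℝ)) ⊗ₖ (1 : Matrix B B ℂ))) :
    D α ρ ((ω' ⊗ₖ σ) ⊗ₖ ω'') = D α (ptB ρ) (ω' ⊗ₖ σ) + D α νABC (νAC ⊗ₖ ω'') := by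
  have hα0 : 0 < α := by
    rcases hα with h | h
    · exact h.1
    · exact zero_lt_one.trans h
  have hα1 : 1 - α ≠ 0 := by
    rcases hα with h | h
    · exact (sub_pos.2 h.2).ne'
    · exact (sub_neg.2 h).ne
  set s : ℝ := (1 - α) / (2 * α) with hs
  have hs0 : s ≠ 0 := div_ne_zero hα1 (by positivity)
  have hss : s + s = (1 - α) / α := by rw [hs]; field_simp; ring
  have hss0 : (1 - α) / α ≠ 0 := div_ne_zero hα1 hα0.ne'
  have hαs : α * s + α * (1 / 2) = 1 / 2 := by rw [hs]; field_simp; ring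
  have hs' : s + 1 / 2 = 1 / (2 * α) := by rw [hs]; field_simp; ring
  -- positivity and supports
  have hR : (ptB ρ).PosSemidef := ptB_posSemidef hρ.1
  have hS : (ω' ⊗ₖ σ).PosSemidef := hω'.1.kronecker hσ
  have hSW : ((ω' ⊗ₖ σ) ⊗ₖ ω'').PosSemidef := hS.kronecker hω''.1
  have hρP := mul_suppProj_of_suppSubset hSW hsupp
  rw [suppProj_kronecker hS hω''.1] at hρP
  have hρS : ρ * (suppProj (ω' ⊗ₖ σ) ⊗ₖ (1 : Matrix B B ℂ)) = ρ := by
    conv_lhs => rw [← hρP]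
    rw [Matrix.mul_assoc, ← Matrix.mul_kronecker_mul, suppProj_mul_suppProj hS, Matrix.mul_one,
      hρP]
  have hρW : ρ * ((1 : Matrix (A × C) (A × C) ℂ) ⊗ₖ suppProj ω'') = ρ := by
    conv_lhs => rw [← hρP]
    rw [Matrix.mul_assoc, ← Matrix.mul_kronecker_mul, suppProj_mul_suppProj hω''.1,
      Matrix.mul_one, hρP]
  have hRS : ptB ρ * suppProj (ω' ⊗ₖ σ) = ptB ρ := by
    have h := ptB_conj (B := B) 1 (suppProj (ω' ⊗ₖ σ)) ρ
    rwa [Matrix.one_kronecker_one, Matrix.one_mul, Matrix.one_mul, hρS, eq_comm] at h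
  have htr : (ptB ρ).trace = 1 := by rw [ptB_trace, hρ.2]
  have hρ0 : ρ ≠ 0 := by
    rintro h
    have := hρ.2
    simp [h] at this
  have hR0 : ptB ρ ≠ 0 := by
    intro h
    simp [h] at htr
  generalize hSdef : ω' ⊗ₖ σ = S at *
  generalize hRdef : ptB ρ = R at *
  -- `K = S^s R^{1/2}` and `M = K† K`
  set K : Matrix (A × C) (A × C) ℂ := mpow S s * mpow R (1 / 2) with hK
  have hrr : mpow R (1 / 2) * mpow R (1 / 2) = R := by
    rw [mpow_mul_mpow hR (r := 1) (by norm_num) one_ne_zero, mpow_one hR]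
  have hKc : Kᴴ = mpow R (1 / 2) * mpow S s := by
    rw [hK, Matrix.conjTranspose_mul, conjTranspose_mpow hR, conjTranspose_mpow hS]
  have hKK : K * Kᴴ = mpow S s * R * mpow S s := by
    rw [hKc, hK, Matrix.mul_assoc, ← Matrix.mul_assoc (mpow R (1 / 2)), hrr, ← Matrix.mul_assoc]
  have hM' : mpow R (1 / 2) * mpow S ((1 - α) / α) * mpow R (1 / 2) = Kᴴ * K := by
    rw [hKc, hK, ← mpow_mul_mpow hS hss hss0]
    simp only [Matrix.mul_assoc]
  rw [hM'] at hνAC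
  have hM : (Kᴴ * K).PosSemidef := Matrix.posSemidef_conjTranspose_mul_self K
  have hMR : (Kᴴ * K) * suppProj R = Kᴴ * K := by
    rw [Matrix.mul_assoc, hK, Matrix.mul_assoc, mpow_mul_suppProj hR (by norm_num)]
  have hctr := trace_mpow_mul_conjTranspose_comm K α
  generalize hMdef : Kᴴ * K = M at *
  have hcpos : 0 < (mpow M α).trace := by
    rw [← hctr, hKK]
    exact trace_mpow_sandwich_pos hR hR0 hS hRS hs0 hα0.ne'
  obtain ⟨c, hc⟩ : ∃ c : ℝ, (mpow M α).trace = (c : ℂ) :=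
    ⟨_, Complex.eq_re_of_ofReal_le hcpos.le⟩
  have hc0 : 0 < c := by
    rw [hc] at hcpos
    exact_mod_cast hcpos
  rw [hc, ← Complex.ofReal_inv] at hνAC
  have hci : 0 ≤ c⁻¹ := (inv_pos.2 hc0).le
  have hMα := mpow_posSemidef hM α
  have hν : νAC.PosSemidef := by
    rw [hνAC]
    exact hMα.smul (by exact_mod_cast hci)
  have hνpow (q : ℝ) : mpow νAC q = (((c⁻¹) ^ q : ℝ) : ℂ) • mpow M (α * q) := by
    rw [hνAC, mpow_smul hMα hci, mpow_mpow hM]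
  have hνR : νAC * suppProj R = νAC := by
    rw [hνAC, Matrix.smul_mul, ← mpow_mul_suppProj hM hα0.ne', suppProj, mpow_one hM]
    simp only [Matrix.mul_assoc, hMR]
  have hνtr : νAC.trace = 1 := by
    rw [hνAC, Matrix.trace_smul, hc, smul_eq_mul, ← Complex.ofReal_mul, inv_mul_cancel₀ hc0.ne',
      Complex.ofReal_one]
  have hνh : mpow νAC (1 / 2) * mpow νAC (1 / 2) = νAC := by
    rw [mpow_mul_mpow hν (r := 1) (by norm_num) one_ne_zero, mpow_one hν]
  -- the conditional operator
  set Ri := mpow R (-(1 / 2) : ℝ) with hRi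
  set T := (Ri ⊗ₖ (1 : Matrix B B ℂ)) * ρ * (Ri ⊗ₖ (1 : Matrix B B ℂ)) with hT
  have hTpos : T.PosSemidef := by
    have h := hρ.1.mul_mul_conjTranspose_same (Ri ⊗ₖ (1 : Matrix B B ℂ))
    rwa [Matrix.conjTranspose_kronecker, Matrix.conjTranspose_one, hRi, conjTranspose_mpow hR]
      at h
  have hρR : ρ * (suppProj R ⊗ₖ (1 : Matrix B B ℂ)) = ρ := by
    rw [← hRdef]
    exact mul_suppProj_ptB hρ.1
  have hRρ : (suppProj R ⊗ₖ (1 : Matrix B B ℂ)) * ρ = ρ := by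
    have h := congrArg Matrix.conjTranspose hρR
    rwa [Matrix.conjTranspose_mul, Matrix.conjTranspose_kronecker, conjTranspose_suppProj hR,
      hρ.1.isHermitian.eq, Matrix.conjTranspose_one] at h
  have hρT : (mpow R (1 / 2) ⊗ₖ (1 : Matrix B B ℂ)) * T * (mpow R (1 / 2) ⊗ₖ (1 : Matrix B B ℂ))
      = ρ := by
    have h1 : (mpow R (1 / 2) ⊗ₖ (1 : Matrix B B ℂ)) * (Ri ⊗ₖ (1 : Matrix B B ℂ))
        = suppProj R ⊗ₖ (1 : Matrix B B ℂ) := by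
      rw [← Matrix.mul_kronecker_mul, hRi, mpow_neg_mul_mpow hR (by norm_num) (by norm_num),
        Matrix.one_mul]
    have h2 : (Ri ⊗ₖ (1 : Matrix B B ℂ)) * (mpow R (1 / 2) ⊗ₖ (1 : Matrix B B ℂ))
        = suppProj R ⊗ₖ (1 : Matrix B B ℂ) := by
      rw [← Matrix.mul_kronecker_mul, hRi, mpow_neg_mul_mpow hR (by norm_num) (by norm_num),
        Matrix.one_mul]
    rw [hT, ← Matrix.mul_assoc, ← Matrix.mul_assoc, h1, hRρ, Matrix.mul_assoc, h2, hρR]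
  have hTW : T * ((1 : Matrix (A × C) (A × C) ℂ) ⊗ₖ suppProj ω'') = T := by
    rw [hT, Matrix.mul_assoc, ← Matrix.mul_kronecker_mul, Matrix.mul_one, Matrix.one_mul]
    conv_rhs => rw [← hρW]
    simp only [Matrix.mul_assoc, ← Matrix.mul_kronecker_mul, Matrix.mul_one, Matrix.one_mul]
  -- supports of the three divergences
  have hsR : suppSubset R S := suppSubset_of_mul_suppProj hS hRS
  have hsν : suppSubset νABC (νAC ⊗ₖ ω'') := by
    apply suppSubset_of_mul_suppProj (hν.kronecker hω''.1)
    rw [suppProj_kronecker hν hω''.1, hνABC, Matrix.mul_assoc, ← Matrix.mul_kronecker_mul,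
      mpow_mul_suppProj hν (by norm_num), Matrix.one_mul]
    conv_rhs => rw [← hTW]
    simp only [Matrix.mul_assoc, ← Matrix.mul_kronecker_mul, Matrix.mul_one, Matrix.one_mul]
  have hνABCtr : νABC.trace = 1 := by
    have hRRR : Ri * R * Ri = suppProj R := by
      conv_lhs => rw [← hrr]
      rw [← Matrix.mul_assoc, Matrix.mul_assoc, hRi,
        mpow_neg_mul_mpow hR (by norm_num) (by norm_num),
        mpow_neg_mul_mpow hR (by norm_num) (by norm_num), suppProj_mul_suppProj hR]
    rw [hνABC, ← ptB_trace, ptB_conj, hT, ptB_conj, hRdef, hRRR, Matrix.trace_mul_comm,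
      ← Matrix.mul_assoc, hνh, hνR, hνtr]
  -- the sandwiched operators
  have hQ : (mpow (mpow (S ⊗ₖ ω'') s * ρ * mpow (S ⊗ₖ ω'') s) α).trace
      = (mpow ((mpow M (1 / 2) ⊗ₖ mpow ω'' s) * T * (mpow M (1 / 2) ⊗ₖ mpow ω'' s)ᴴ) α).trace := by
    have hL : Kᴴ * K = (mpow M (1 / 2))ᴴ * mpow M (1 / 2) := by
      rw [hMdef, conjTranspose_mpow hM, mpow_mul_mpow hM (r := 1) (by norm_num) one_ne_zero,
        mpow_one hM]
    have e1 : K ⊗ₖ mpow ω'' s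
        = (mpow S s ⊗ₖ mpow ω'' s) * (mpow R (1 / 2) ⊗ₖ (1 : Matrix B B ℂ)) := by
      rw [← Matrix.mul_kronecker_mul, Matrix.mul_one]
    have e2 : (K ⊗ₖ mpow ω'' s)ᴴ
        = (mpow R (1 / 2) ⊗ₖ (1 : Matrix B B ℂ)) * (mpow S s ⊗ₖ mpow ω'' s) := by
      rw [Matrix.conjTranspose_kronecker, conjTranspose_mpow hω''.1, hKc,
        ← Matrix.mul_kronecker_mul, Matrix.one_mul]
    have e3 : mpow (S ⊗ₖ ω'') s * ρ * mpow (S ⊗ₖ ω'') s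
        = (K ⊗ₖ mpow ω'' s) * T * (K ⊗ₖ mpow ω'' s)ᴴ := by
      rw [mpow_kronecker hS hω''.1, e2, e1]
      conv_lhs => rw [← hρT]
      simp only [Matrix.mul_assoc]
    rw [← trace_mpow_conj_congr hTpos hL, e3]
  set t : ℝ := (c⁻¹) ^ (1 / (2 * α)) with ht
  have ht0 : 0 ≤ t := Real.rpow_nonneg hci _
  have htα : (t * t) ^ α = c⁻¹ := by
    rw [ht, ← Real.rpow_add (inv_pos.2 hc0), ← Real.rpow_mul hci]
    convert Real.rpow_one _
    field_simp
    norm_num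
  have hνs : mpow νAC s * mpow νAC (1 / 2) = (t : ℂ) • mpow M (1 / 2) := by
    rw [hνpow, hνpow, Matrix.smul_mul, Matrix.mul_smul, smul_smul,
      mpow_mul_mpow hM hαs (by norm_num), ← Complex.ofReal_mul,
      ← Real.rpow_add (inv_pos.2 hc0), hs']
  have hνs' : mpow νAC (1 / 2) * mpow νAC s = (t : ℂ) • mpow M (1 / 2) := by
    rw [hνpow, hνpow, Matrix.smul_mul, Matrix.mul_smul, smul_smul,
      mpow_mul_mpow hM ((add_comm _ _).trans hαs) (by norm_num),
      ← Complex.ofReal_mul, ← Real.rpow_add (inv_pos.2 hc0), add_comm, hs']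
  have hQ' : (mpow (mpow (νAC ⊗ₖ ω'') s * νABC * mpow (νAC ⊗ₖ ω'') s) α).trace
      = ((c⁻¹ : ℝ) : ℂ) * (mpow (mpow (S ⊗ₖ ω'') s * ρ * mpow (S ⊗ₖ ω'') s) α).trace := by
    have e : mpow (νAC ⊗ₖ ω'') s * νABC * mpow (νAC ⊗ₖ ω'') s = ((t * t : ℝ) : ℂ) •
        ((mpow M (1 / 2) ⊗ₖ mpow ω'' s) * T * (mpow M (1 / 2) ⊗ₖ mpow ω'' s)ᴴ) := by
      rw [mpow_kronecker hν hω''.1, hνABC, Matrix.conjTranspose_kronecker,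
        conjTranspose_mpow hω''.1, conjTranspose_mpow hM]
      calc _ = ((mpow νAC s ⊗ₖ mpow ω'' s) * (mpow νAC (1 / 2) ⊗ₖ (1 : Matrix B B ℂ))) * T *
            ((mpow νAC (1 / 2) ⊗ₖ (1 : Matrix B B ℂ)) * (mpow νAC s ⊗ₖ mpow ω'' s)) := by
            simp only [Matrix.mul_assoc]
        _ = _ := by
            rw [← Matrix.mul_kronecker_mul, ← Matrix.mul_kronecker_mul, Matrix.mul_one,
              Matrix.one_mul, hνs, hνs', Matrix.smul_kronecker,
              Matrix.smul_mul, Matrix.smul_mul, Matrix.mul_smul, smul_smul, Complex.ofReal_mul]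
    rw [e, mpow_smul (hTpos.mul_mul_conjTranspose_same _) (mul_nonneg ht0 ht0),
      Matrix.trace_smul, smul_eq_mul, htα, hQ]
  have hQpos : 0 < (mpow (mpow (S ⊗ₖ ω'') s * ρ * mpow (S ⊗ₖ ω'') s) α).trace := by
    refine trace_mpow_sandwich_pos hρ.1 hρ0 hSW ?_ hs0 hα0.ne'
    rw [suppProj_kronecker hS hω''.1, hρP]
  have hQre := (Complex.pos_iff.1 hQpos).1
  rw [D_of_suppSubset α hsupp, D_of_suppSubset α hsR, D_of_suppSubset α hsν, ← EReal.coe_add]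
  congr 1
  simp only [DR]
  rw [← hs, hρ.2, htr, hνABCtr, ← hKK, hctr, hc, hQ', Complex.re_ofReal_mul, Complex.ofReal_re,
    Complex.one_re, div_one, div_one, div_one, Real.logb_mul (inv_pos.2 hc0).ne' hQre.ne',
    Real.logb_inv]
  ring

end QITLeak
end
end
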